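/- Let μ ∈ ℝ be irrational and set A_j = μj + θ for j ∈ ℤ. Then σ(L_A) is the same set for every θ ∈ ℝ, and, viewed as a subset of ℝ, it is a nonempty compact set with no isolated points, empty interior, and Lebesgue measure zero. -/

import Mathlib

open Real MeasureTheory Filter

/-- The Jacobi operator with off-diagonal entries `a`, acting on real sequences. -/
def jacobi (a ψ : ℤ → ℝ) (j : ℤ) : ℝ := a j * ψ (j + 1) + a (j - 1) * ψ (j - 1)

/-- `ψ` is a finitely supported `ε`-approximate eigenvector of `jacobi a` at energy `x`. -/
def IsQuasimode (a : ℤ → ℝ) (x ε : ℝ) (ψ : ℤ → ℝ) : Prop :=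
  ψ.support.Finite ∧ ψ ≠ 0 ∧ ∑' j, (jacobi a ψ j - x * ψ j) ^ 2 ≤ ε ^ 2 * ∑' j, ψ j ^ 2

theorem summable_sq_of_finite_support {w : ℤ → ℝ} (hw : w.support.Finite) :
    Summable fun j => w j ^ 2 := by
  refine summable_of_hasFiniteSupport (hw.subset fun j hj => ?_)
  simpa using hj

theorem finite_support_comp_add {w : ℤ → ℝ} (hw : w.support.Finite) (k : ℤ) :
    (fun j => w (j + k)).support.Finite :=
  hw.preimage (f := fun j : ℤ => j + k) (by intro i _ j _ h; simpa using h)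

theorem finite_support_jacobi_sub {w : ℤ → ℝ} (hw : w.support.Finite) (a : ℤ → ℝ) (x : ℝ) :
    (fun j => jacobi a w j - x * w j).support.Finite := by
  refine (((finite_support_comp_add hw 1).union (finite_support_comp_add hw (-1))).union
    hw).subset fun j hj => ?_
  by_contra hcon
  simp only [Set.mem_union, Function.mem_support, not_or, not_not, ← sub_eq_add_neg] at hcon
  exact hj (by simp [jacobi, hcon.1.1, hcon.1.2, hcon.2])

theorem isUnit_of_isSelfAdjoint_of_le_norm {E : Type*} [NormedAddCommGroup E]
    [InnerProductSpace ℂ E] [CompleteSpace E] {T : E →L[ℂ] E} (hT : IsSelfAdjoint T)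
    {c : ℝ} (hc : 0 < c) (h : ∀ φ, c * ‖φ‖ ≤ ‖T φ‖) : IsUnit T := by
  rw [ContinuousLinearMap.isUnit_iff_bijective,
    ContinuousLinearMap.bijective_iff_dense_range_and_antilipschitz]
  have anti : AntilipschitzWith (⟨c, hc.le⟩ : NNReal)⁻¹ T := by
    refine ContinuousLinearMap.antilipschitz_of_bound T fun φ => ?_
    have := h φ
    have e : (((⟨c, hc.le⟩ : NNReal)⁻¹ : NNReal) : ℝ) = c⁻¹ := rfl
    rw [e, inv_mul_eq_div, le_div_iff₀ hc]; linarith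
  refine ⟨?_, _, anti⟩
  rw [Submodule.topologicalClosure_eq_top_iff, ContinuousLinearMap.orthogonal_range,
    hT.adjoint_eq, LinearMap.ker_eq_bot]
  exact anti.injective

/-- Membership of a real number in the spectrum of a self-adjoint operator, by Weyl's
criterion. -/
theorem mem_spectrum_iff_forall_exists_norm_lt {E : Type*} [NormedAddCommGroup E]
    [InnerProductSpace ℂ E] [CompleteSpace E] {T : E →L[ℂ] E} (hT : IsSelfAdjoint T) (x : ℝ) :
    (x : ℂ) ∈ spectrum ℂ T ↔ ∀ ε > 0, ∃ φ, ‖T φ - (x : ℂ) • φ‖ < ε * ‖φ‖ := by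
  have hS : IsSelfAdjoint (T - algebraMap ℂ (E →L[ℂ] E) (x : ℂ)) := by
    refine hT.sub ?_
    rw [Algebra.algebraMap_eq_smul_one]
    exact IsSelfAdjoint.smul (Complex.conj_ofReal x) (IsSelfAdjoint.one _)
  have happ : ∀ φ, (T - algebraMap ℂ (E →L[ℂ] E) (x : ℂ)) φ = T φ - (x : ℂ) • φ := by
    intro φ; simp [Algebra.algebraMap_eq_smul_one]
  rw [spectrum.mem_iff, ← IsUnit.neg_iff, neg_sub]
  constructor
  · intro hu ε hε
    by_contra! hcon
    exact hu (isUnit_of_isSelfAdjoint_of_le_norm hS hε fun φ => by rw [happ]; exact hcon φ)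
  · rintro h ⟨u, hu⟩
    obtain ⟨φ, hφ⟩ := h (‖(↑u⁻¹ : E →L[ℂ] E)‖ + 1)⁻¹ (by positivity)
    have h1 : (↑u⁻¹ : E →L[ℂ] E) (T φ - (x : ℂ) • φ) = φ := by
      rw [← happ, ← hu, ← mul_apply_eq_comp, Units.inv_mul]; rfl
    have h2 := (↑u⁻¹ : E →L[ℂ] E).le_opNorm (T φ - (x : ℂ) • φ)
    rw [h1] at h2
    rw [inv_mul_eq_div, lt_div_iff₀ (by positivity)] at hφ
    nlinarith [norm_nonneg (T φ - (x : ℂ) • φ)]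

section Chain

variable {a : ℤ → ℝ} {L : lp (fun _ : ℤ => ℂ) 2 →L[ℂ] lp (fun _ : ℤ => ℂ) 2}

theorem isSelfAdjoint_of_jacobi
    (hL : ∀ (φ : lp (fun _ : ℤ => ℂ) 2) (j : ℤ),
      L φ j = (a j : ℂ) * φ (j + 1) + (a (j - 1) : ℂ) * φ (j - 1)) : IsSelfAdjoint L := by
  have hs : ∀ j : ℤ, L (lp.single 2 j (1 : ℂ)) =
      lp.single 2 (j - 1) (a (j - 1) : ℂ) + lp.single 2 (j + 1) (a j : ℂ) := by
    intro j
    ext i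
    rw [hL]
    simp only [lp.coeFn_add, Pi.add_apply, lp.single_apply, Pi.single_apply]
    by_cases h1 : i = j - 1
    · subst h1
      have : j - 1 ≠ j + 1 := by omega
      have : j - 1 - 1 ≠ j := by omega
      simp [*]
    · by_cases h2 : i = j + 1
      · subst h2
        have : j + 1 + 1 ≠ j := by omega
        simp [*]
      · have : i + 1 ≠ j := by omega
        have : i - 1 ≠ j := by omega
        simp [*]
  rw [ContinuousLinearMap.isSelfAdjoint_iff']
  ext φ j
  have e1 : ∀ ψ : lp (fun _ : ℤ => ℂ) 2, ψ j = inner ℂ (lp.single 2 j (1 : ℂ)) ψ := by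
    intro ψ; rw [lp.inner_single_left]; simp
  rw [e1 (ContinuousLinearMap.adjoint L φ), ContinuousLinearMap.adjoint_inner_right, hs,
    inner_add_left, lp.inner_single_left, lp.inner_single_left, hL]
  simp [mul_comm, add_comm]

theorem lp_norm_sq_eq_tsum (φ : lp (fun _ : ℤ => ℂ) 2) : ‖φ‖ ^ 2 = ∑' j, ‖φ j‖ ^ 2 := by
  have := lp.norm_rpow_eq_tsum (p := 2) (by norm_num) φ
  simpa using this

/-- A finitely supported sequence as an element of `ℓ²`. -/
theorem exists_lp_of_finite_support {ψ : ℤ → ℝ} (h : ψ.support.Finite) :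
    ∃ φ : lp (fun _ : ℤ => ℂ) 2, ∀ j, φ j = (ψ j : ℂ) := by
  refine ⟨⟨fun j => (ψ j : ℂ), ?_⟩, fun j => rfl⟩
  refine (memℓp_zero ?_).of_exponent_ge zero_le
  refine h.subset fun j hj => ?_
  simpa using hj

theorem IsQuasimode.norm_le
    (hL : ∀ (φ : lp (fun _ : ℤ => ℂ) 2) (j : ℤ),
      L φ j = (a j : ℂ) * φ (j + 1) + (a (j - 1) : ℂ) * φ (j - 1))
    {x ε : ℝ} (hε : 0 ≤ ε) {ψ : ℤ → ℝ} (h : IsQuasimode a x ε ψ) {φ : lp (fun _ : ℤ => ℂ) 2}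
    (hφ : ∀ j, φ j = (ψ j : ℂ)) : ‖L φ - (x : ℂ) • φ‖ ≤ ε * ‖φ‖ := by
  have e : ∀ j, (L φ - (x : ℂ) • φ) j = ((jacobi a ψ j - x * ψ j : ℝ) : ℂ) := by
    intro j
    have : (L φ - (x : ℂ) • φ) j = L φ j - (x : ℂ) * φ j := rfl
    rw [this, hL, hφ, hφ, hφ, jacobi]
    push_cast; ring
  refine le_of_sq_le_sq ?_ (by positivity)
  rw [mul_pow, lp_norm_sq_eq_tsum, lp_norm_sq_eq_tsum]
  simpa only [e, hφ, Complex.norm_real, Real.norm_eq_abs, sq_abs] using h.2.2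

theorem mem_spectrum_iff_forall_exists_isQuasimode
    (hL : ∀ (φ : lp (fun _ : ℤ => ℂ) 2) (j : ℤ),
      L φ j = (a j : ℂ) * φ (j + 1) + (a (j - 1) : ℂ) * φ (j - 1)) (x : ℝ) :
    (x : ℂ) ∈ spectrum ℂ L ↔ ∀ ε > 0, ∃ ψ, IsQuasimode a x ε ψ := by
  rw [mem_spectrum_iff_forall_exists_norm_lt (isSelfAdjoint_of_jacobi hL)]
  constructor
  · intro h ε hε
    obtain ⟨φ, hφ⟩ := h ε hε
    -- density of finitely supported sequences
    have hd : ∀ᶠ s : Finset ℤ in atTop,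
        ‖L (∑ i ∈ s, lp.single 2 i (φ i)) - (x : ℂ) • (∑ i ∈ s, lp.single 2 i (φ i))‖
          < ε * ‖∑ i ∈ s, lp.single 2 i (φ i)‖ := by
      have ht : Tendsto (fun s : Finset ℤ => ∑ i ∈ s, lp.single 2 i (φ i)) atTop (nhds φ) :=
        lp.hasSum_single (by norm_num) φ
      refine (ht.eventually (p := fun φ => ‖L φ - (x : ℂ) • φ‖ < ε * ‖φ‖) ?_)
      exact IsOpen.mem_nhds (isOpen_lt (by fun_prop) (by fun_prop)) hφ
    obtain ⟨s, hs⟩ := hd.exists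
    set f := ∑ i ∈ s, lp.single 2 i (φ i) with hf
    have hsupp : ∀ j ∉ s, f j = 0 := by
      intro j hj
      rw [hf, lp.coeFn_sum, Finset.sum_apply]
      refine Finset.sum_eq_zero fun i hi => ?_
      rw [lp.single_apply_ne]
      rintro rfl; exact hj hi
    -- real and imaginary parts
    set u : ℤ → ℝ := fun j => (f j).re
    set v : ℤ → ℝ := fun j => (f j).im
    have hu : u.support.Finite := by
      refine s.finite_toSet.subset fun j hj => ?_
      by_contra hjs
      exact hj (by simp [u, hsupp j hjs])
    have hv : v.support.Finite := by
      refine s.finite_toSet.subset fun j hj => ?_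
      by_contra hjs
      exact hj (by simp [v, hsupp j hjs])
    have sumu := summable_sq_of_finite_support hu
    have sumv := summable_sq_of_finite_support hv
    have fin_jac : ∀ w : ℤ → ℝ, w.support.Finite →
        Summable fun j => (jacobi a w j - x * w j) ^ 2 := fun w hw =>
      summable_sq_of_finite_support (finite_support_jacobi_sub hw a x)
    have key : ∑' j, (jacobi a u j - x * u j) ^ 2 + ∑' j, (jacobi a v j - x * v j) ^ 2
        < ε ^ 2 * (∑' j, u j ^ 2 + ∑' j, v j ^ 2) := by
      have h1 := pow_lt_pow_left₀ hs (norm_nonneg _) two_ne_zero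
      rw [mul_pow, lp_norm_sq_eq_tsum, lp_norm_sq_eq_tsum] at h1
      have e1 : ∀ j, ‖f j‖ ^ 2 = u j ^ 2 + v j ^ 2 := by
        intro j; rw [← Complex.normSq_eq_norm_sq, Complex.normSq_apply]; ring
      have e2 : ∀ j, ‖(L f - (x : ℂ) • f) j‖ ^ 2 =
          (jacobi a u j - x * u j) ^ 2 + (jacobi a v j - x * v j) ^ 2 := by
        intro j
        have : (L f - (x : ℂ) • f) j = L f j - (x : ℂ) * f j := rfl
        rw [← Complex.normSq_eq_norm_sq, Complex.normSq_apply, this, hL]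
        simp [jacobi, u, v]
        ring
      simp only [e1, e2] at h1
      rwa [sumu.tsum_add sumv, (fin_jac u hu).tsum_add (fin_jac v hv)] at h1
    by_contra! hcon
    have alt : ∀ w : ℤ → ℝ, w.support.Finite →
        ε ^ 2 * ∑' j, w j ^ 2 ≤ ∑' j, (jacobi a w j - x * w j) ^ 2 := by
      intro w hw
      by_cases h0 : w = 0
      · subst h0; simp [jacobi]
      · by_contra! hlt
        exact hcon w ⟨hw, h0, hlt.le⟩
    linarith [alt u hu, alt v hv]
  · intro h ε hε
    obtain ⟨ψ, hψ⟩ := h (ε / 2) (by positivity)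
    obtain ⟨φ, hφ⟩ := exists_lp_of_finite_support hψ.1
    refine ⟨φ, (hψ.norm_le hL (by positivity) hφ).trans_lt ?_⟩
    have : 0 < ‖φ‖ := by
      rw [norm_pos_iff]
      rintro rfl
      apply hψ.2.1
      ext j
      have := hφ j
      simpa using this.symm
    nlinarith
end Chain

theorem IsQuasimode.mono {a ψ : ℤ → ℝ} {x ε ε' : ℝ} (h : IsQuasimode a x ε ψ) (h0 : 0 ≤ ε)
    (hle : ε ≤ ε') : IsQuasimode a x ε' ψ :=
  ⟨h.1, h.2.1, h.2.2.trans (by gcongr)⟩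

theorem tsum_comp_add_sq (w : ℤ → ℝ) (k : ℤ) : ∑' j, w (j + k) ^ 2 = ∑' j, w j ^ 2 :=
  (Equiv.addRight k).tsum_eq fun j => w j ^ 2

theorem tsum_jacobi_sq_le {d ψ : ℤ → ℝ} {δ : ℝ} (hψ : ψ.support.Finite)
    (hd : ∀ j, ψ j ≠ 0 ∨ ψ (j + 1) ≠ 0 → |d j| ≤ δ) :
    ∑' j, jacobi d ψ j ^ 2 ≤ 4 * δ ^ 2 * ∑' j, ψ j ^ 2 := by
  have s1 := summable_sq_of_finite_support (finite_support_comp_add hψ 1)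
  have s2 := summable_sq_of_finite_support (finite_support_comp_add hψ (-1))
  have s0 : Summable fun j => jacobi d ψ j ^ 2 := by
    simpa using summable_sq_of_finite_support (finite_support_jacobi_sub hψ d 0)
  have hb : ∀ j i, (ψ i ≠ 0 → |d j| ≤ δ) → (d j * ψ i) ^ 2 ≤ δ ^ 2 * ψ i ^ 2 := by
    intro j i h
    by_cases h0 : ψ i = 0
    · simp [h0]
    · rw [mul_pow]
      have : d j ^ 2 ≤ δ ^ 2 := by rw [← sq_abs]; gcongr; exact h h0
      gcongr
  calc ∑' j, jacobi d ψ j ^ 2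
      ≤ ∑' j, (2 * δ ^ 2 * ψ (j + 1) ^ 2 + 2 * δ ^ 2 * ψ (j + -1) ^ 2) := by
        refine Summable.tsum_le_tsum (fun j => ?_) s0 ((s1.mul_left _).add (s2.mul_left _))
        have h1 := hb j (j + 1) fun h => hd j (Or.inr h)
        have h2 := hb (j - 1) (j - 1) fun h => hd (j - 1) (Or.inl h)
        rw [jacobi, ← sub_eq_add_neg]
        nlinarith [sq_nonneg (d j * ψ (j + 1) - d (j - 1) * ψ (j - 1))]
    _ = 4 * δ ^ 2 * ∑' j, ψ j ^ 2 := by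
        rw [(s1.mul_left _).tsum_add (s2.mul_left _), tsum_mul_left, tsum_mul_left,
          tsum_comp_add_sq, tsum_comp_add_sq]
        ring

theorem IsQuasimode.perturb {a a' ψ : ℤ → ℝ} {x ε δ : ℝ} (hε : 0 ≤ ε) (hδ : 0 ≤ δ)
    (h : IsQuasimode a x ε ψ) (hd : ∀ j, ψ j ≠ 0 ∨ ψ (j + 1) ≠ 0 → |a' j - a j| ≤ δ) :
    IsQuasimode a' x (2 * ε + 3 * δ) ψ := by
  obtain ⟨hf, h0, hq⟩ := h
  refine ⟨hf, h0, ?_⟩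
  have s0 := summable_sq_of_finite_support (finite_support_jacobi_sub hf a x)
  have s1 := summable_sq_of_finite_support (finite_support_jacobi_sub hf a' x)
  have s2 : Summable fun j => jacobi (a' - a) ψ j ^ 2 := by
    simpa using summable_sq_of_finite_support (finite_support_jacobi_sub hf (a' - a) 0)
  have hp := tsum_jacobi_sq_le hf (d := a' - a) hd
  have hn : 0 ≤ ∑' j, ψ j ^ 2 := tsum_nonneg fun j => sq_nonneg _
  calc ∑' j, (jacobi a' ψ j - x * ψ j) ^ 2
      ≤ ∑' j, (2 * (jacobi a ψ j - x * ψ j) ^ 2 + 2 * jacobi (a' - a) ψ j ^ 2) := by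
        refine Summable.tsum_le_tsum (fun j => ?_) s1 ((s0.mul_left _).add (s2.mul_left _))
        have : jacobi a' ψ j = jacobi a ψ j + jacobi (a' - a) ψ j := by
          simp only [jacobi, Pi.sub_apply]; ring
        rw [this]
        nlinarith [sq_nonneg (jacobi a ψ j - x * ψ j - jacobi (a' - a) ψ j)]
    _ = 2 * ∑' j, (jacobi a ψ j - x * ψ j) ^ 2 + 2 * ∑' j, jacobi (a' - a) ψ j ^ 2 := by
        rw [(s0.mul_left _).tsum_add (s2.mul_left _), tsum_mul_left, tsum_mul_left]
    _ ≤ (2 * ε ^ 2 + 8 * δ ^ 2) * ∑' j, ψ j ^ 2 := by linarith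
    _ ≤ (2 * ε + 3 * δ) ^ 2 * ∑' j, ψ j ^ 2 := by
        gcongr
        nlinarith [mul_nonneg hε hδ, sq_nonneg ε, sq_nonneg δ]

theorem IsQuasimode.translate {a ψ : ℤ → ℝ} {x ε : ℝ} (h : IsQuasimode a x ε ψ) (n : ℤ) :
    IsQuasimode (fun j => a (j + n)) x ε (fun j => ψ (j + n)) := by
  obtain ⟨hf, h0, hq⟩ := h
  refine ⟨finite_support_comp_add hf n, fun h => h0 ?_, ?_⟩
  · ext j
    simpa using congrFun h (j - n)
  · rw [tsum_comp_add_sq]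
    have e : ∀ j, jacobi (fun j => a (j + n)) (fun j => ψ (j + n)) j - x * ψ (j + n)
        = (fun i => jacobi a ψ i - x * ψ i) (j + n) := by
      intro j
      simp only [jacobi]
      rw [show j + 1 + n = j + n + 1 by ring, show j - 1 + n = j + n - 1 by ring]
    simp only [e]
    rwa [tsum_comp_add_sq (fun i => jacobi a ψ i - x * ψ i)]

/-- The off-diagonal entries of the chain operator. -/
noncomputable def coupling (μ θ : ℝ) (j : ℤ) : ℝ := 2 * Real.cos (π * (μ * j + θ))

theorem abs_coupling_sub_le (μ θ ν κ : ℝ) (i j m : ℤ) :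
    |coupling μ θ i - coupling ν κ j| ≤ 2 * π * |μ * i + θ - (ν * j + κ) - 2 * m| := by
  have : coupling ν κ j = 2 * Real.cos (π * (ν * j + κ) + m * (2 * π)) := by
    rw [Real.cos_add_int_mul_two_pi, coupling]
  rw [this, coupling, ← mul_sub, abs_mul, abs_two, mul_assoc]
  gcongr
  refine (abs_cos_sub_cos_le _ _).trans (le_of_eq ?_)
  rw [show π * (μ * i + θ) - (π * (ν * j + κ) + m * (2 * π))
    = π * (μ * i + θ - (ν * j + κ) - 2 * m) by ring, abs_mul, abs_of_pos Real.pi_pos]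

theorem exists_small_multiple {μ : ℝ} (hμ : Irrational μ) {δ : ℝ} (hδ : 0 < δ) :
    ∃ n m : ℤ, 0 < n ∧ 0 < |μ * n - 2 * m| ∧ |μ * n - 2 * m| < δ := by
  obtain ⟨N, hN⟩ := exists_nat_one_div_lt (half_pos hδ)
  obtain ⟨j, k, hk, -, h⟩ := Real.exists_int_int_abs_mul_sub_le (μ / 2) N.succ_pos
  refine ⟨k, j, hk, ?_, ?_⟩
  · rw [abs_pos]
    have h1 := (hμ.mul_intCast hk.ne').sub_intCast (2 * j)
    have := h1.ne_zero
    push_cast at this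
    exact this
  · have h2 : μ * k - 2 * j = 2 * (k * (μ / 2) - j) := by ring
    rw [h2, abs_mul, abs_two]
    have h3 : (1 : ℝ) / ((N.succ : ℕ) + 1) ≤ 1 / (N + 1) := by
      push_cast
      gcongr
      linarith
    linarith

theorem exists_int_combination_near {μ : ℝ} (hμ : Irrational μ) (t : ℝ) {δ : ℝ} (hδ : 0 < δ) :
    ∃ n m : ℤ, |μ * n - 2 * m - t| < δ := by
  obtain ⟨n, m, -, h0, h1⟩ := exists_small_multiple hμ hδ
  set η := μ * n - 2 * m with hη
  refine ⟨n * round (t / η), m * round (t / η), ?_⟩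
  have hη0 : η ≠ 0 := abs_pos.mp h0
  have e : μ * ((n * round (t / η) : ℤ) : ℝ) - 2 * ((m * round (t / η) : ℤ) : ℝ) - t
      = -(η * (t / η - round (t / η))) := by
    push_cast
    rw [mul_sub, mul_div_cancel₀ _ hη0, hη]; ring
  rw [e, abs_neg, abs_mul]
  have := abs_sub_round (t / η)
  nlinarith [abs_nonneg (t / η - round (t / η))]

theorem exists_isQuasimode_coupling {μ : ℝ} (hμ : Irrational μ) (θ θ' x : ℝ)
    (h : ∀ ε > 0, ∃ ψ, IsQuasimode (coupling μ θ) x ε ψ) :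
    ∀ ε > 0, ∃ ψ, IsQuasimode (coupling μ θ') x ε ψ := by
  intro ε hε
  obtain ⟨ψ, hψ⟩ := h (ε / 4) (by positivity)
  obtain ⟨n, m, hnm⟩ := exists_int_combination_near hμ (θ' - θ)
    (δ := ε / (12 * π)) (by positivity)
  have := (hψ.translate n).perturb (a' := coupling μ θ') (δ := ε / 6) (by positivity)
    (by positivity) fun j _ => by
      refine (abs_coupling_sub_le μ θ' μ θ j (j + n) (-m)).trans ?_
      have e : μ * j + θ' - (μ * ((j + n : ℤ) : ℝ) + θ) - 2 * ((-m : ℤ) : ℝ)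
          = -(μ * n - 2 * m - (θ' - θ)) := by push_cast; ring
      rw [e, abs_neg]
      calc 2 * π * |μ * n - 2 * m - (θ' - θ)| ≤ 2 * π * (ε / (12 * π)) := by gcongr
        _ = ε / 6 := by field_simp; norm_num
  rw [show 2 * (ε / 4) + 3 * (ε / 6) = ε by ring] at this
  exact ⟨_, this⟩

theorem exists_eq_of_coupling_eq_zero {μ θ : ℝ} {i : ℤ} (h : coupling μ θ i = 0) :
    ∃ m : ℤ, μ * i + θ = (2 * m + 1) / 2 := by
  rw [coupling, mul_eq_zero_iff_left two_ne_zero, Real.cos_eq_zero_iff] at h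
  obtain ⟨m, hm⟩ := h
  refine ⟨m, mul_left_cancel₀ Real.pi_ne_zero ?_⟩
  rw [hm]; ring

theorem exists_forall_ne_coupling_ne_zero {μ : ℝ} (hμ : Irrational μ) (θ : ℝ) :
    ∃ k : ℤ, ∀ j ≠ k, coupling μ θ j ≠ 0 := by
  by_cases h : ∃ k, coupling μ θ k = 0
  · obtain ⟨k, hk⟩ := h
    refine ⟨k, fun j hj h0 => ?_⟩
    obtain ⟨m, hm⟩ := exists_eq_of_coupling_eq_zero h0
    obtain ⟨m', hm'⟩ := exists_eq_of_coupling_eq_zero hk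
    have h1 := (hμ.mul_intCast (sub_ne_zero.mpr hj)).sub_intCast (m - m')
    apply h1.ne_zero
    push_cast
    linarith
  · push Not at h
    exact ⟨0, fun j _ => h j⟩

/-- At an isolated point of the spectrum, a normal operator minus that point has a
pseudo-inverse. -/
theorem exists_pseudoinverse_of_isolated {A : Type*} [CStarAlgebra A] {T : A}
    (hT : IsStarNormal T) {z : ℂ} (h : ∀ᶠ w in nhds z, w ∈ spectrum ℂ T → w = z) :
    ∃ G : A, (T - algebraMap ℂ A z) * G * (T - algebraMap ℂ A z) = T - algebraMap ℂ A z := by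
  have hg : ContinuousOn (fun w : ℂ => (w - z)⁻¹) (spectrum ℂ T) := by
    intro w hw
    by_cases hz : w = z
    · subst hz
      have : nhdsWithin w (spectrum ℂ T) ≤ pure w := by
        rw [le_pure_iff]
        exact mem_nhdsWithin_iff_eventually.mpr h
      exact (tendsto_pure_nhds _ _).mono_left this
    · exact ((continuousAt_id.sub continuousAt_const).inv₀ (sub_ne_zero.mpr hz)).continuousWithinAt
  have h1 : cfc (fun w : ℂ => w - z) T = T - algebraMap ℂ A z := by
    rw [cfc_sub (fun w : ℂ => w) (fun _ => z) T, cfc_id' ℂ T, cfc_const z T]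
  refine ⟨cfc (fun w : ℂ => (w - z)⁻¹) T, ?_⟩
  rw [← h1, ← cfc_mul (fun w : ℂ => w - z) (fun w : ℂ => (w - z)⁻¹) T, ← cfc_mul _ _ T]
  · refine cfc_congr fun w _ => ?_
    by_cases hz : w = z
    · simp [hz]
    · simp [sub_ne_zero.mpr hz]

theorem eq_zero_of_jacobi_eigen {a : ℤ → ℝ} {w : ℤ → ℂ} {x : ℂ} {k : ℤ} (ha : ∀ j ≠ k, a j ≠ 0)
    (hw : ∀ j, (a j : ℂ) * w (j + 1) + (a (j - 1) : ℂ) * w (j - 1) = x * w j)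
    (h0 : w k = 0) (h1 : w (k + 1) = 0) : w = 0 := by
  have fwd : ∀ n : ℕ, w (k + n) = 0 ∧ w (k + n + 1) = 0 := by
    intro n
    induction n with
    | zero => simpa using ⟨h0, h1⟩
    | succ n ih =>
      have e := hw (k + n + 1)
      rw [ih.2, show k + n + 1 - 1 = k + n by ring, ih.1, mul_zero, mul_zero, add_zero] at e
      push_cast
      rw [← add_assoc]
      exact ⟨ih.2, (mul_eq_zero.mp e).resolve_left (by exact_mod_cast ha _ (by omega))⟩
  have bwd : ∀ n : ℕ, w (k - n) = 0 ∧ w (k - n + 1) = 0 := by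
    intro n
    induction n with
    | zero => simpa using ⟨h0, h1⟩
    | succ n ih =>
      have e := hw (k - n)
      rw [ih.1, ih.2, mul_zero, mul_zero, zero_add] at e
      push_cast
      rw [show k - ((n : ℤ) + 1) = k - n - 1 by ring, show k - (n : ℤ) - 1 + 1 = k - n by ring]
      exact ⟨(mul_eq_zero.mp e).resolve_left (by exact_mod_cast ha _ (by omega)), ih.1⟩
  ext j
  rcases le_total k j with h | h
  · have := (fwd (j - k).toNat).1
    rwa [show k + ((j - k).toNat : ℤ) = j by omega] at this
  · have := (bwd (k - j).toNat).1
    rwa [show k - ((k - j).toNat : ℤ) = j by omega] at this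

/-- Almost periodicity: a quasimode can be moved far away. -/
theorem exists_three_quasimodes {μ : ℝ} (hμ : Irrational μ) (θ x : ℝ)
    (h : ∀ ε > 0, ∃ ψ, IsQuasimode (coupling μ θ) x ε ψ) {ε : ℝ} (hε : 0 < ε) :
    ∃ (ψ : ℤ → ℝ) (n : ℤ), (∀ k : Fin 3, IsQuasimode (coupling μ θ) x ε
      fun j => ψ (j + k * n)) ∧ ∀ k l : Fin 3, k ≠ l → ∀ j, ψ (j + k * n) * ψ (j + l * n) = 0 := by
  obtain ⟨ψ, hψ⟩ := h (ε / 4) (by positivity)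
  obtain ⟨R, hR⟩ : ∃ R : ℕ, ∀ j : ℤ, ψ j ≠ 0 → |j| < R := by
    obtain ⟨B, hB⟩ := (hψ.1.image fun j => |j|).bddAbove
    refine ⟨(B + 1).toNat, fun j hj => ?_⟩
    have : |j| ≤ B := hB ⟨j, hj, rfl⟩
    omega
  set N : ℝ := 2 * R + 1 with hN
  have hNpos : 0 < N := by positivity
  obtain ⟨n, m, hn, -, hnm⟩ := exists_small_multiple hμ (δ := ε / (24 * π * N)) (by positivity)
  refine ⟨ψ, n * (2 * R + 1), fun k => ?_, fun k l hkl j => ?_⟩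
  · have := (hψ.translate (k * (n * (2 * R + 1)))).perturb (a' := coupling μ θ) (δ := ε / 6)
      (by positivity) (by positivity) fun j _ => by
        refine (abs_coupling_sub_le μ θ μ θ j (j + k * (n * (2 * R + 1)))
          (-(k * (m * (2 * R + 1))))).trans ?_
        have e : μ * j + θ - (μ * ((j + k * (n * (2 * R + 1)) : ℤ) : ℝ) + θ)
            - 2 * ((-(k * (m * (2 * R + 1))) : ℤ) : ℝ)
            = -((k : ℕ) * N * (μ * n - 2 * m)) := by push_cast; rw [hN]; ring
        have hk : ((k : ℕ) : ℝ) ≤ 2 := by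
          have := k.2
          exact_mod_cast (by omega : (k : ℕ) ≤ 2)
        rw [e, abs_neg, abs_mul, abs_of_nonneg (by positivity)]
        calc 2 * π * ((k : ℕ) * N * |μ * n - 2 * m|)
            ≤ 2 * π * (2 * N * (ε / (24 * π * N))) := by gcongr
          _ = ε / 6 := by field_simp; norm_num
    rwa [show 2 * (ε / 4) + 3 * (ε / 6) = ε by ring] at this
  · by_contra hne
    obtain ⟨h1, h2⟩ := mul_ne_zero_iff.mp hne
    have h1 := hR _ h1
    have h2 := hR _ h2
    have hkl' : (k : ℤ) ≠ l := by
      intro h; apply hkl; ext; exact_mod_cast h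
    have h3 : |((k : ℤ) - l) * (n * (2 * R + 1))| < 2 * R := by
      have e : ((k : ℤ) - l) * (n * (2 * R + 1))
        = (j + k * (n * (2 * R + 1))) - (j + l * (n * (2 * R + 1))) := by ring
      rw [e]
      exact (abs_sub _ _).trans_lt (by linarith)
    rw [abs_mul, abs_mul] at h3
    have h4 : 1 ≤ |(k : ℤ) - l| := Int.one_le_abs (sub_ne_zero.mpr hkl')
    have h5 : 1 ≤ |n| := Int.one_le_abs hn.ne'
    have h6 : |2 * (R : ℤ) + 1| = 2 * R + 1 := abs_of_nonneg (by positivity)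
    rw [h6] at h3
    nlinarith [mul_le_mul h4 h5 zero_le_one (by positivity)]

theorem accPt_of_mem_spectrum {μ : ℝ} (hμ : Irrational μ) (θ : ℝ)
    {L : lp (fun _ : ℤ => ℂ) 2 →L[ℂ] lp (fun _ : ℤ => ℂ) 2}
    (hL : ∀ (φ : lp (fun _ : ℤ => ℂ) 2) (j : ℤ),
      L φ j = (coupling μ θ j : ℂ) * φ (j + 1) + (coupling μ θ (j - 1) : ℂ) * φ (j - 1))
    {x : ℝ} (hx : (x : ℂ) ∈ spectrum ℂ L) :
    AccPt x (Filter.principal (Complex.ofReal ⁻¹' spectrum ℂ L)) := by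
  have hsa := isSelfAdjoint_of_jacobi hL
  by_contra hacc
  rw [accPt_iff_frequently, not_frequently] at hacc
  have hiso : ∀ᶠ w in nhds (x : ℂ), w ∈ spectrum ℂ L → w = x := by
    have ht : Tendsto Complex.re (nhds (x : ℂ)) (nhds x) := Complex.continuous_re.tendsto' _ _ rfl
    filter_upwards [ht.eventually hacc] with w hw hmem
    have hre := hsa.mem_spectrum_eq_re hmem
    by_contra hne
    refine hw ⟨fun h => hne ?_, ?_⟩
    · rw [hre, h]
    · rw [Set.mem_preimage, ← hre]; exact hmem
  obtain ⟨G, hG⟩ := exists_pseudoinverse_of_isolated hsa.isStarNormal hiso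
  set S := L - algebraMap ℂ (lp (fun _ : ℤ => ℂ) 2 →L[ℂ] lp (fun _ : ℤ => ℂ) 2) x with hS
  have hSapp : ∀ φ, S φ = L φ - (x : ℂ) • φ := by
    intro φ; rw [hS, Algebra.algebraMap_eq_smul_one]; rfl
  set ε : ℝ := (6 * (‖G‖ + 1))⁻¹ with hε
  have hεpos : 0 < ε := by positivity
  obtain ⟨ψ, n, hq, hdisj⟩ := exists_three_quasimodes hμ θ x
    ((mem_spectrum_iff_forall_exists_isQuasimode hL x).mp hx) hεpos
  choose φ hφ using fun k : Fin 3 => exists_lp_of_finite_support (hq k).1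
  have hb : ∀ k, ‖S (φ k)‖ ≤ ε * ‖φ k‖ := fun k => by
    rw [hSapp]; exact (hq k).norm_le hL hεpos.le (hφ k)
  have hpos : ∀ k, 0 < ‖φ k‖ := fun k => by
    rw [norm_pos_iff]
    intro h0
    apply (hq k).2.1
    ext j
    have := hφ k j
    rw [h0] at this
    simpa using this.symm
  have horth : ∀ k l, k ≠ l → inner ℂ (φ k) (φ l) = 0 := fun k l hkl => by
    rw [lp.inner_eq_tsum]
    have : ∀ j, inner ℂ (φ k j) (φ l j) = 0 := fun j => by
      rw [hφ, hφ, RCLike.inner_apply]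
      have := hdisj k l hkl j
      rw [mul_comm] at this
      simp only [Complex.conj_ofReal]
      exact_mod_cast this
    rw [tsum_congr this, tsum_zero]
  obtain ⟨k, hk⟩ := exists_forall_ne_coupling_ne_zero hμ θ
  -- a combination of the three quasimodes on which `S` is inverted by `G`
  let V : (Fin 3 → ℂ) →ₗ[ℂ] lp (fun _ : ℤ => ℂ) 2 := Fintype.linearCombination ℂ φ
  let ev : lp (fun _ : ℤ => ℂ) 2 →ₗ[ℂ] (Fin 2 → ℂ) :=
    { toFun := fun w => ![w k, w (k + 1)]
      map_add' := fun u v => by ext i; fin_cases i <;> simp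
      map_smul' := fun c v => by ext i; fin_cases i <;> simp }
  let Pr : lp (fun _ : ℤ => ℂ) 2 →L[ℂ] lp (fun _ : ℤ => ℂ) 2 := 1 - G * S
  obtain ⟨c, hc, hc0⟩ : ∃ c ∈ LinearMap.ker (ev ∘ₗ (Pr : _ →ₗ[ℂ] _) ∘ₗ V), c ≠ 0 :=
    (Submodule.ne_bot_iff _).mp (LinearMap.ker_ne_bot_of_finrank_lt (by simp))
  set v := V c with hv
  have hPv : Pr v = 0 := by
    have hSP : S (Pr v) = 0 := by
      have : S * Pr = 0 := by
        simp only [Pr, mul_sub, mul_one, ← mul_assoc, hG, sub_self]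
      simpa using DFunLike.congr_fun this v
    have hev : ev (Pr v) = 0 := hc
    have := eq_zero_of_jacobi_eigen (a := coupling μ θ) (w := Pr v) (x := x) hk (fun j => by
      rw [← hL]
      have h1 : (S (Pr v)) j = 0 := by rw [hSP]; rfl
      rw [hSapp] at h1
      exact sub_eq_zero.mp h1) (congrFun hev 0) (congrFun hev 1)
    ext j
    exact congrFun this j
  have hvG : v = G (S v) := by
    have : v - G (S v) = 0 := hPv
    exact sub_eq_zero.mp this
  have hvsum : v = ∑ i, c i • φ i := by
    rw [hv]; exact Fintype.linearCombination_apply ℂ φ c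
  have hci : ∀ i, ‖c i‖ * ‖φ i‖ ≤ ‖v‖ := fun i => by
    have h1 : inner ℂ (φ i) v = c i * (‖φ i‖ : ℂ) ^ 2 := by
      rw [hvsum, inner_sum, Finset.sum_eq_single i]
      · rw [inner_smul_right, inner_self_eq_norm_sq_to_K]; rfl
      · intro l _ hl
        rw [inner_smul_right, horth i l hl.symm, mul_zero]
      · simp
    have h2 := norm_inner_le_norm (𝕜 := ℂ) (φ i) v
    rw [h1, norm_mul, norm_pow, Complex.norm_real, norm_norm] at h2
    have := hpos i
    nlinarith
  have hSv : ‖S v‖ ≤ 3 * ε * ‖v‖ := by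
    rw [hvsum, map_sum]
    refine (norm_sum_le _ _).trans ?_
    rw [← hvsum]
    calc ∑ i, ‖S (c i • φ i)‖ ≤ ∑ _i : Fin 3, ε * ‖v‖ := by
          refine Finset.sum_le_sum fun i _ => ?_
          rw [map_smul, norm_smul]
          have := hci i
          have := hb i
          nlinarith [norm_nonneg (c i)]
      _ = 3 * ε * ‖v‖ := by simp; ring
  have hv0 : 0 < ‖v‖ := by
    obtain ⟨i, hi⟩ := Function.ne_iff.mp hc0
    exact (mul_pos (norm_pos_iff.mpr hi) (hpos i)).trans_le (hci i)
  have h1 : ‖v‖ ≤ ‖G‖ * (3 * ε * ‖v‖) := by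
    calc ‖v‖ = ‖G (S v)‖ := by rw [← hvG]
      _ ≤ ‖G‖ * ‖S v‖ := G.le_opNorm _
      _ ≤ _ := by gcongr
  have h2 : ‖G‖ * (3 * ε) < 1 := by
    rw [hε, mul_inv, ← mul_assoc, ← mul_assoc, mul_inv_lt_iff₀ (by positivity)]
    linarith [norm_nonneg G]
  nlinarith

/-- The tent function of width one. -/
noncomputable def tent (y : ℝ) : ℝ := max (1 - |y|) 0

theorem abs_tent_sub_le (y z : ℝ) : |tent y - tent z| ≤ |y - z| := by
  refine (abs_max_sub_max_le_abs _ _ _).trans ?_ |>.trans (abs_abs_sub_abs_le y z)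
  rw [abs_sub_comm]
  exact le_of_eq (by congr 1; ring)

theorem tent_nonneg (y : ℝ) : 0 ≤ tent y := le_max_right _ _

theorem tent_le_one (y : ℝ) : tent y ≤ 1 := max_le (by linarith [abs_nonneg y]) zero_le_one

theorem abs_lt_one_of_tent_ne_zero {y : ℝ} (h : tent y ≠ 0) : |y| < 1 := by
  by_contra! hy
  exact h (max_eq_right (by linarith))

theorem mem_floor_pair_of_tent_ne_zero {y : ℝ} {k : ℤ} (h : tent (y - k) ≠ 0) :
    k ∈ ({⌊y⌋, ⌊y⌋ + 1} : Finset ℤ) := by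
  have h1 := abs_lt.mp (abs_lt_one_of_tent_ne_zero h)
  have h2 : ⌊y⌋ - 1 < k := by
    rw [← Int.cast_lt (R := ℝ)]
    push_cast
    linarith [Int.floor_le y]
  have h3 : k < ⌊y⌋ + 2 := by
    rw [← Int.cast_lt (R := ℝ)]
    push_cast
    linarith [Int.lt_floor_add_one y]
  simp only [Finset.mem_insert, Finset.mem_singleton]
  omega

theorem sum_le_card_mul_of_support_subset {F G : Finset ℤ} {f : ℤ → ℝ} {c : ℝ}
    (h0 : ∀ k, 0 ≤ f k) (hc : ∀ k, f k ≤ c) (hf : ∀ k, f k ≠ 0 → k ∈ G) :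
    ∑ k ∈ F, f k ≤ G.card * c := by
  calc ∑ k ∈ F, f k ≤ ∑ k ∈ F ∪ G, f k :=
        Finset.sum_le_sum_of_subset_of_nonneg Finset.subset_union_left fun k _ _ => h0 k
    _ = ∑ k ∈ G, f k := (Finset.sum_subset Finset.subset_union_right fun k _ hk => by
        by_contra h; exact hk (hf k h)).symm
    _ ≤ G.card * c := by
        rw [← nsmul_eq_mul]; exact Finset.sum_le_card_nsmul _ _ _ fun k _ => hc k

theorem sum_tent_sq_le (F : Finset ℤ) (y : ℝ) : ∑ k ∈ F, tent (y - k) ^ 2 ≤ 2 := by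
  refine (sum_le_card_mul_of_support_subset (G := {⌊y⌋, ⌊y⌋ + 1}) (c := 1)
    (fun k => sq_nonneg _) (fun k => ?_) fun k hk => ?_).trans ?_
  · have := tent_nonneg (y - k)
    have := tent_le_one (y - k)
    nlinarith
  · exact mem_floor_pair_of_tent_ne_zero (fun h => hk (by simp [h]))
  · rw [mul_one]
    exact_mod_cast Finset.card_le_two

theorem half_le_sum_tent_sq {F : Finset ℤ} {y : ℝ} (h : ⌊y⌋ ∈ F) (h' : ⌊y⌋ + 1 ∈ F) :
    1 / 2 ≤ ∑ k ∈ F, tent (y - k) ^ 2 := by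
  have hsub : ({⌊y⌋, ⌊y⌋ + 1} : Finset ℤ) ⊆ F := by
    intro k hk
    simp only [Finset.mem_insert, Finset.mem_singleton] at hk
    rcases hk with rfl | rfl <;> assumption
  refine le_trans ?_ (Finset.sum_le_sum_of_subset_of_nonneg hsub fun k _ _ => sq_nonneg _)
  rw [Finset.sum_pair (by omega)]
  have h0 := Int.fract_nonneg y
  have h1 := Int.fract_lt_one y
  have e1 : tent (y - ⌊y⌋) = 1 - Int.fract y := by
    rw [Int.self_sub_floor, tent, abs_of_nonneg h0, max_eq_left (by linarith)]
  have e2 : tent (y - (⌊y⌋ + 1 : ℤ)) = Int.fract y := by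
    have : y - (⌊y⌋ + 1 : ℤ) = Int.fract y - 1 := by
      push_cast; rw [← Int.self_sub_floor]; ring
    rw [this, tent, abs_of_nonpos (by linarith), max_eq_left (by linarith)]
    ring
  rw [e1, e2]
  nlinarith [sq_nonneg (2 * Int.fract y - 1)]

theorem sum_tent_sub_sq_le (F : Finset ℤ) (y z : ℝ) :
    ∑ k ∈ F, (tent (y - k) - tent (z - k)) ^ 2 ≤ 4 * (y - z) ^ 2 := by
  refine (sum_le_card_mul_of_support_subset (G := {⌊y⌋, ⌊y⌋ + 1} ∪ {⌊z⌋, ⌊z⌋ + 1})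
    (c := (y - z) ^ 2) (fun k => sq_nonneg _) (fun k => ?_) fun k hk => ?_).trans ?_
  · rw [sq_le_sq]
    simpa using abs_tent_sub_le (y - k) (z - k)
  · rw [Finset.mem_union]
    by_contra! hcon
    have h1 : tent (y - k) = 0 := by
      by_contra h; exact hcon.1 (mem_floor_pair_of_tent_ne_zero h)
    have h2 : tent (z - k) = 0 := by
      by_contra h; exact hcon.2 (mem_floor_pair_of_tent_ne_zero h)
    exact hk (by simp [h1, h2])
  · gcongr
    have h1 := Finset.card_union_le ({⌊y⌋, ⌊y⌋ + 1} : Finset ℤ) {⌊z⌋, ⌊z⌋ + 1}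
    have h2 := Finset.card_le_two (a := ⌊y⌋) (b := ⌊y⌋ + 1)
    have h3 := Finset.card_le_two (a := ⌊z⌋) (b := ⌊z⌋ + 1)
    exact_mod_cast (by omega : ({⌊y⌋, ⌊y⌋ + 1} ∪ {⌊z⌋, ⌊z⌋ + 1} : Finset ℤ).card ≤ 4)

/-- Localization of quasimodes: if the clock `s` runs at speed at most `1 / |a|`, then a
quasimode can be localized to a window of `s`-length `2 T` at the cost of an error
proportional to `1 / T`. -/
theorem IsQuasimode.localize {a s ψ : ℤ → ℝ} {x T : ℝ} (hT : 0 < T)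
    (hs : ∀ j, |a j| * |s (j + 1) - s j| ≤ 1) (h : IsQuasimode a x (1 / T) ψ) :
    ∃ ψ' t, IsQuasimode a x (9 / T) ψ' ∧ ∀ j, ψ' j ≠ 0 → |s j - t| < T := by
  obtain ⟨hf, h0, hq⟩ := h
  set χ : ℤ → ℤ → ℝ := fun k j => tent (s j / T - k) with hχ
  set w : ℤ → ℤ → ℝ := fun k j => χ k j * ψ j with hw
  have hwf : ∀ k, (w k).support.Finite := fun k =>
    hf.subset fun j hj => right_ne_zero_of_mul hj
  by_contra! hcon
  have hlow : ∀ k, (9 / T) ^ 2 * ∑' j, w k j ^ 2 ≤ ∑' j, (jacobi a (w k) j - x * w k j) ^ 2 := by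
    intro k
    by_cases hk : w k = 0
    · rw [hk]; simp [jacobi]
    · by_contra! hlt
      obtain ⟨j, hj, hj'⟩ := hcon (w k) (k * T) ⟨hwf k, hk, hlt.le⟩
      have h1 := abs_lt_one_of_tent_ne_zero (left_ne_zero_of_mul hj)
      have h2 : s j / T - k = (s j - k * T) / T := by field_simp
      rw [h2, abs_div, abs_of_pos hT, div_lt_one hT] at h1
      linarith
  set F : Finset ℤ := hf.toFinset.image (fun j => ⌊s j / T⌋) ∪
    hf.toFinset.image (fun j => ⌊s j / T⌋ + 1) with hF
  have sumψ := summable_sq_of_finite_support hf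
  have sumr := summable_sq_of_finite_support (finite_support_jacobi_sub hf a x)
  have s1 := summable_sq_of_finite_support (finite_support_comp_add hf 1)
  have s2 := summable_sq_of_finite_support (finite_support_comp_add hf (-1))
  have hpos : 0 < ∑' j, ψ j ^ 2 := by
    obtain ⟨j, hj⟩ := Function.ne_iff.mp h0
    exact sumψ.tsum_pos (fun j => sq_nonneg _) j (by positivity [show ψ j ≠ 0 from hj])
  have lower : (9 / T) ^ 2 * (1 / 2) * ∑' j, ψ j ^ 2 ≤
      ∑ k ∈ F, ∑' j, (jacobi a (w k) j - x * w k j) ^ 2 := by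
    calc (9 / T) ^ 2 * (1 / 2) * ∑' j, ψ j ^ 2
        = (9 / T) ^ 2 * ∑' j, (1 / 2) * ψ j ^ 2 := by rw [tsum_mul_left]; ring
      _ ≤ (9 / T) ^ 2 * ∑' j, ∑ k ∈ F, w k j ^ 2 := by
          gcongr ?_ * ?_
          refine Summable.tsum_le_tsum (fun j => ?_) (sumψ.mul_left _)
            (summable_sum fun k _ => summable_sq_of_finite_support (hwf k))
          by_cases hj : ψ j = 0
          · simp [hw, hj]
          · simp only [hw, mul_pow, ← Finset.sum_mul]
            gcongr
            refine half_le_sum_tent_sq ?_ ?_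
            · exact Finset.mem_union_left _ (Finset.mem_image_of_mem _ (by simpa using hj))
            · exact Finset.mem_union_right _ (Finset.mem_image.mpr ⟨j, by simpa using hj, rfl⟩)
      _ = ∑ k ∈ F, (9 / T) ^ 2 * ∑' j, w k j ^ 2 := by
          rw [Summable.tsum_finsetSum fun k _ => summable_sq_of_finite_support (hwf k),
            Finset.mul_sum]
      _ ≤ _ := Finset.sum_le_sum fun k _ => hlow k
  have diff : ∀ j, ∑ k ∈ F, (a j * (χ k (j + 1) - χ k j)) ^ 2 ≤ 4 / T ^ 2 := by
    intro j
    simp only [mul_pow, ← Finset.mul_sum]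
    calc a j ^ 2 * ∑ k ∈ F, (χ k (j + 1) - χ k j) ^ 2
        ≤ a j ^ 2 * (4 * (s (j + 1) / T - s j / T) ^ 2) := by
          gcongr
          exact sum_tent_sub_sq_le F _ _
      _ = 4 / T ^ 2 * (|a j| * |s (j + 1) - s j|) ^ 2 := by
          rw [mul_pow, sq_abs, sq_abs]; field_simp
      _ ≤ 4 / T ^ 2 * 1 ^ 2 := by gcongr; exact hs j
      _ = 4 / T ^ 2 := by ring
  have upper : ∑ k ∈ F, ∑' j, (jacobi a (w k) j - x * w k j) ^ 2 ≤
      36 / T ^ 2 * ∑' j, ψ j ^ 2 := by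
    rw [← Summable.tsum_finsetSum fun k _ =>
      summable_sq_of_finite_support (finite_support_jacobi_sub (hwf k) a x)]
    calc ∑' j, ∑ k ∈ F, (jacobi a (w k) j - x * w k j) ^ 2
        ≤ ∑' j, (4 * (jacobi a ψ j - x * ψ j) ^ 2 +
            (16 / T ^ 2 * ψ (j + 1) ^ 2 + 16 / T ^ 2 * ψ (j + -1) ^ 2)) := by
          refine Summable.tsum_le_tsum (fun j => ?_)
            (summable_sum fun k _ =>
              summable_sq_of_finite_support (finite_support_jacobi_sub (hwf k) a x))
            ((sumr.mul_left _).add ((s1.mul_left _).add (s2.mul_left _)))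
          have d1 := diff j
          have d2 := diff (j - 1)
          have d3 := sum_tent_sq_le F (s j / T)
          rw [sub_add_cancel] at d2
          rw [← sub_eq_add_neg]
          calc ∑ k ∈ F, (jacobi a (w k) j - x * w k j) ^ 2
              ≤ ∑ k ∈ F, (2 * (jacobi a ψ j - x * ψ j) ^ 2 * χ k j ^ 2 +
                (4 * ψ (j + 1) ^ 2 * (a j * (χ k (j + 1) - χ k j)) ^ 2 +
                4 * ψ (j - 1) ^ 2 * (a (j - 1) * (χ k j - χ k (j - 1))) ^ 2)) := by
                refine Finset.sum_le_sum fun k _ => ?_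
                have e : jacobi a (w k) j - x * w k j = χ k j * (jacobi a ψ j - x * ψ j) +
                  (a j * (χ k (j + 1) - χ k j) * ψ (j + 1) -
                  a (j - 1) * (χ k j - χ k (j - 1)) * ψ (j - 1)) := by
                  simp only [jacobi, hw]; ring
                rw [e]
                set A := χ k j * (jacobi a ψ j - x * ψ j)
                set B := a j * (χ k (j + 1) - χ k j) * ψ (j + 1)
                set C := a (j - 1) * (χ k j - χ k (j - 1)) * ψ (j - 1)
                have : (A + (B - C)) ^ 2 ≤ 2 * A ^ 2 + (4 * B ^ 2 + 4 * C ^ 2) := by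
                  nlinarith [sq_nonneg (A - (B - C)), sq_nonneg (B + C)]
                refine this.trans (le_of_eq ?_)
                simp only [A, B, C]; ring
            _ = 2 * (jacobi a ψ j - x * ψ j) ^ 2 * ∑ k ∈ F, χ k j ^ 2 +
                (4 * ψ (j + 1) ^ 2 * ∑ k ∈ F, (a j * (χ k (j + 1) - χ k j)) ^ 2 +
                4 * ψ (j - 1) ^ 2 * ∑ k ∈ F, (a (j - 1) * (χ k j - χ k (j - 1))) ^ 2) := by
                simp only [Finset.sum_add_distrib, Finset.mul_sum]
            _ ≤ 2 * (jacobi a ψ j - x * ψ j) ^ 2 * 2 +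
                (4 * ψ (j + 1) ^ 2 * (4 / T ^ 2) + 4 * ψ (j - 1) ^ 2 * (4 / T ^ 2)) := by
                gcongr
            _ = _ := by ring
      _ = 4 * ∑' j, (jacobi a ψ j - x * ψ j) ^ 2 + 32 / T ^ 2 * ∑' j, ψ j ^ 2 := by
          rw [(sumr.mul_left _).tsum_add ((s1.mul_left _).add (s2.mul_left _)),
            (s1.mul_left _).tsum_add (s2.mul_left _), tsum_mul_left, tsum_mul_left,
            tsum_mul_left, tsum_comp_add_sq, tsum_comp_add_sq]
          ring
      _ ≤ 4 * ((1 / T) ^ 2 * ∑' j, ψ j ^ 2) + 32 / T ^ 2 * ∑' j, ψ j ^ 2 := by gcongr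
      _ = _ := by ring
  have := lower.trans upper
  rw [mul_le_mul_iff_left₀ hpos, div_pow] at this
  have h2 : 0 < 1 / T ^ 2 := by positivity
  have e1 : (9 : ℝ) ^ 2 / T ^ 2 * (1 / 2) = 40.5 * (1 / T ^ 2) := by ring
  have e2 : 36 / T ^ 2 = 36 * (1 / T ^ 2) := by ring
  rw [e1, e2] at this
  linarith

theorem exists_rat_large_den {μ : ℝ} (hμ : Irrational μ) (R : ℕ) :
    ∃ x : ℚ, R ≤ x.den ∧ |μ - x| < 1 / (x.den : ℝ) ^ 2 := by
  by_contra! hcon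
  refine Real.infinite_rat_abs_sub_lt_one_div_den_sq_of_irrational hμ ?_
  set M : ℤ := ⌈(|μ| + 1) * R⌉
  refine Set.Finite.of_finite_image (f := fun x : ℚ => (x.num, x.den))
    ((Set.finite_Icc (-M) M |>.prod (Set.finite_Iio R)).subset ?_) fun x _ y _ h => ?_
  · rintro _ ⟨x, hx, rfl⟩
    have hx : |μ - x| < 1 / (x.den : ℝ) ^ 2 := hx
    have hR : x.den < R := by
      by_contra! h
      exact (hcon x h).not_gt hx
    refine ⟨?_, hR⟩
    have hd : (1 : ℝ) ≤ x.den := by exact_mod_cast x.pos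
    have h1 : |μ - x| ≤ 1 := by
      refine hx.le.trans ?_
      rw [div_le_one (by positivity)]
      nlinarith
    have h2 : |(x : ℝ)| ≤ |μ| + 1 := by
      have := abs_sub_abs_le_abs_sub (x : ℝ) μ
      rw [abs_sub_comm] at this
      linarith
    have h3 : |(x.num : ℝ)| ≤ (|μ| + 1) * R := by
      have e : (x.num : ℝ) = x * x.den := by exact_mod_cast (Rat.mul_den_eq_num x).symm
      rw [e, abs_mul, Nat.abs_cast]
      gcongr
    have h4 : |(x.num : ℝ)| ≤ M := h3.trans (Int.le_ceil _)
    have h5 : |x.num| ≤ M := by exact_mod_cast h4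
    exact abs_le.mp h5
  · simp only [Prod.mk.injEq] at h
    exact Rat.ext h.1 h.2

theorem exists_forall_add_one_sub_eq (f : ℤ → ℝ) : ∃ s : ℤ → ℝ, ∀ j, s (j + 1) - s j = f j := by
  refine ⟨fun j => ∑ i ∈ Finset.range j.toNat, f i -
    ∑ i ∈ Finset.range (-j).toNat, f (-(i + 1)), fun j => ?_⟩
  dsimp only
  rcases le_or_gt 0 j with hj | hj
  · rw [show (j + 1).toNat = j.toNat + 1 by omega, show (-(j + 1)).toNat = 0 by omega,
      show (-j).toNat = 0 by omega, Finset.sum_range_succ, Int.toNat_of_nonneg hj]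
    simp
  · rw [show (j + 1).toNat = 0 by omega, show j.toNat = 0 by omega,
      show (-j).toNat = (-(j + 1)).toNat + 1 by omega, Finset.sum_range_succ,
      Int.toNat_of_nonneg (by omega)]
    simp

theorem sum_comp_add_mul_emod {r : ℕ} {p : ℤ} (hr : 0 < r) (h : IsCoprime p (r : ℤ)) (l : ℤ)
    (g : ℕ → ℝ) :
    ∑ i ∈ Finset.range r, g ((l + i * p) % r).toNat = ∑ k ∈ Finset.range r, g k := by
  have hr' : (0 : ℤ) < r := by exact_mod_cast hr
  have hinj : Set.InjOn (fun i : ℕ => ((l + i * p) % r).toNat) (Finset.range r : Set ℕ) := by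
    intro i hi j hj hij
    simp only [Finset.coe_range, Set.mem_Iio] at hi hj hij
    have h1 := Int.emod_nonneg (l + i * p) hr'.ne'
    have h2 := Int.emod_nonneg (l + j * p) hr'.ne'
    have h3 : (l + i * p) % r = (l + j * p) % r := by omega
    have h4 : (r : ℤ) ∣ (j - i) * p := by
      have h5 := Int.ModEq.dvd (show (l + i * p) ≡ (l + j * p) [ZMOD r] from h3)
      convert h5 using 1; ring
    have h6 := h.symm.dvd_of_dvd_mul_right h4
    have h7 := Int.eq_zero_of_abs_lt_dvd h6 (by rw [abs_lt]; omega)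
    omega
  have himg : (Finset.range r).image (fun i : ℕ => ((l + i * p) % r).toNat) = Finset.range r := by
    refine Finset.eq_of_subset_of_card_le (fun k hk => ?_) ?_
    · obtain ⟨i, -, rfl⟩ := Finset.mem_image.mp hk
      have h1 := Int.emod_lt_of_pos (l + i * p) hr'
      simp only [Finset.mem_range]
      omega
    · rw [Finset.card_image_of_injOn hinj]
  conv_rhs => rw [← himg, Finset.sum_image hinj]

theorem abs_coupling_le (μ θ : ℝ) (j m : ℤ) :
    |coupling μ θ j| ≤ 2 * π * |μ * j + θ - 1 / 2 - m| := by
  have h : Real.cos (π * (1 / 2 + m)) = 0 := by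
    rw [show π * (1 / 2 + m) = (2 * (m : ℝ) + 1) * π / 2 by ring]
    exact Real.cos_eq_zero_iff.mpr ⟨m, rfl⟩
  have h2 := abs_cos_sub_cos_le (π * (μ * j + θ)) (π * (1 / 2 + m))
  rw [h, sub_zero, ← mul_sub, abs_mul π, abs_of_pos Real.pi_pos] at h2
  rw [coupling, abs_mul, abs_two, mul_assoc]
  rw [show μ * j + θ - 1 / 2 - m = μ * j + θ - (1 / 2 + m) by ring]
  gcongr

theorem exists_forall_le_sum_inv_abs_coupling {μ : ℝ} (hμ : Irrational μ) {θ : ℝ}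
    (hθ : ∀ j, coupling μ θ j ≠ 0) (K : ℝ) :
    ∃ r : ℕ, 0 < r ∧ ∀ n : ℤ, K * r ≤ ∑ i ∈ Finset.range r, 1 / |coupling μ θ (n + i)| := by
  obtain ⟨R, hR⟩ := (Real.tendsto_sum_range_one_div_nat_succ_atTop.eventually_ge_atTop
    (4 * π * K)).exists_forall_of_atTop
  obtain ⟨x, hx, hx'⟩ := exists_rat_large_den hμ R
  refine ⟨x.den, x.pos, fun n => ?_⟩
  set r := x.den
  have hr0 : (0 : ℝ) < r := by exact_mod_cast x.pos
  have hr1 : (1 : ℝ) ≤ r := by exact_mod_cast x.pos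
  set y := μ * n + θ - 1 / 2 with hy
  set l := ⌊r * y⌋ with hl
  have hcop : IsCoprime x.num (r : ℤ) := Int.isCoprime_iff_gcd_eq_one.mpr x.reduced
  have hterm : ∀ i ∈ Finset.range r, r / (2 * π) * (1 / (((l + i * x.num) % r).toNat + 2))
      ≤ 1 / |coupling μ θ (n + i)| := by
    intro i hi
    have hi : (i : ℝ) < r := by exact_mod_cast Finset.mem_range.mp hi
    set d := (l + i * x.num) / r with hd
    set k := ((l + i * x.num) % r).toNat with hk
    have hk' : (k : ℤ) = (l + i * x.num) % r :=
      Int.toNat_of_nonneg (Int.emod_nonneg _ (by exact_mod_cast x.pos.ne'))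
    have hdk : (l : ℝ) + i * x.num = r * d + k := by
      have := Int.emod_add_mul_ediv (l + i * x.num) r
      rw [← hk', ← hd] at this
      have h2 : ((l + i * x.num : ℤ) : ℝ) = ((k + r * d : ℤ) : ℝ) := by rw [this]
      push_cast at h2
      linarith
    have hxe : (x.num : ℝ) = x * r := by exact_mod_cast (Rat.mul_den_eq_num x).symm
    have hc := abs_coupling_le μ θ (n + i) d
    have hb : |μ * ((n + i : ℤ) : ℝ) + θ - 1 / 2 - d| ≤ (k + 2) / r := by
      have e : μ * ((n + i : ℤ) : ℝ) + θ - 1 / 2 - d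
          = (k + (r * y - l)) / r + (μ - x) * i := by
        field_simp
        rw [hxe] at hdk
        push_cast
        rw [hy]
        linear_combination 2 * hdk
      have h1 : |(μ - x) * i| ≤ 1 / r := by
        rw [abs_mul, Nat.abs_cast]
        calc |μ - x| * i ≤ 1 / (r : ℝ) ^ 2 * r := by gcongr
          _ = 1 / r := by field_simp
      have h2 : |(k + (r * y - l)) / r| ≤ (k + 1) / r := by
        rw [abs_div, abs_of_pos hr0, abs_of_nonneg]
        · gcongr; linarith [Int.lt_floor_add_one (r * y)]
        · linarith [Int.floor_le (r * y), (k.cast_nonneg : (0 : ℝ) ≤ k)]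
      rw [e]
      refine (abs_add_le _ _).trans ((add_le_add h2 h1).trans (le_of_eq ?_))
      ring
    have hpos := abs_pos.mpr (hθ (n + i))
    rw [le_div_iff₀ hpos]
    calc (r : ℝ) / (2 * π) * (1 / (k + 2)) * |coupling μ θ (n + i)|
        ≤ r / (2 * π) * (1 / (k + 2)) * (2 * π * ((k + 2) / r)) := by
          gcongr
          exact hc.trans (by gcongr)
      _ = 1 := by field_simp
  calc K * r = r / (2 * π) * (1 / 2 * (4 * π * K)) := by field_simp; ring
    _ ≤ r / (2 * π) * (1 / 2 * ∑ k ∈ Finset.range r, 1 / ((k : ℝ) + 1)) := by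
        gcongr
        exact hR r hx
    _ ≤ r / (2 * π) * ∑ k ∈ Finset.range r, 1 / ((k : ℝ) + 2) := by
        rw [Finset.mul_sum]
        gcongr with k
        rw [div_mul_div_comm]
        gcongr
        · norm_num
        · linarith [(k.cast_nonneg : (0 : ℝ) ≤ k)]
    _ = ∑ i ∈ Finset.range r, r / (2 * π) * (1 / (((l + i * x.num) % r).toNat + 2)) := by
        rw [← Finset.mul_sum, sum_comp_add_mul_emod x.pos hcop l (fun k => 1 / ((k : ℝ) + 2))]
    _ ≤ _ := Finset.sum_le_sum hterm

theorem exists_window_of_localized {s ψ : ℤ → ℝ} {t T : ℝ} {N : ℕ} (hs : Monotone s)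
    (hN : ∀ n, 2 * T ≤ s (n + N) - s n) (h0 : ψ ≠ 0) (hf : ψ.support.Finite)
    (h : ∀ j, ψ j ≠ 0 → |s j - t| < T) : ∃ n, ∀ j, ψ j ≠ 0 → n ≤ j ∧ j < n + N := by
  obtain ⟨i, hi⟩ := Function.ne_iff.mp h0
  obtain ⟨n, hn, hmin⟩ := hf.exists_minimal ⟨i, hi⟩
  refine ⟨n, fun j hj => ?_⟩
  have hnj : n ≤ j := by
    by_contra! hlt
    exact hlt.not_ge (hmin hj hlt.le)
  refine ⟨hnj, ?_⟩
  by_contra! hle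
  have h1 := hs hle
  have h2 := abs_lt.mp (h j hj)
  have h3 := abs_lt.mp (h n hn)
  linarith [hN n]

theorem coupling_half_ne_zero {μ : ℝ} (hμ : Irrational μ) (j : ℤ) :
    coupling μ ((1 + μ) / 2) j ≠ 0 := by
  intro h
  obtain ⟨m, hm⟩ := exists_eq_of_coupling_eq_zero h
  have h1 := (hμ.mul_intCast (show 2 * j + 1 ≠ 0 by omega)).sub_intCast (2 * m)
  apply h1.ne_zero
  push_cast
  linarith

theorem coupling_ratCast_ne_zero (ν : ℚ) {θ : ℝ} (hθ : Irrational θ) (j : ℤ) :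
    coupling ν θ j ≠ 0 := by
  intro h
  obtain ⟨m, hm⟩ := exists_eq_of_coupling_eq_zero h
  apply (hθ.ratCast_add (ν * j)).ne_rat ((2 * m + 1) / 2)
  push_cast
  exact hm

theorem exists_rat_forall_isQuasimode {μ : ℝ} (hμ : Irrational μ) {k : ℕ} (hk : 2 ≤ k) :
    ∃ ν : ℚ, k ≤ ν.den ∧ ∀ θ x, (∀ ε > 0, ∃ ψ, IsQuasimode (coupling μ θ) x ε ψ) →
      ∃ θ' ψ, (∀ j, coupling ν θ' j ≠ 0) ∧ IsQuasimode (coupling ν θ') x (120 / (k * ν.den)) ψ ∧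
        ∀ j, ψ j ≠ 0 → 1 ≤ j ∧ j + 1 < ν.den := by
  have hk0 : (2 : ℝ) ≤ k := by exact_mod_cast hk
  have hne := coupling_half_ne_zero hμ
  set a := coupling μ ((1 + μ) / 2) with ha
  obtain ⟨r, hr, hrK⟩ := exists_forall_le_sum_inv_abs_coupling hμ hne (k ^ 2)
  obtain ⟨ν, hνd, hν⟩ := exists_rat_large_den hμ (k * r + 4)
  set q := ν.den
  have hq4 : (4 : ℝ) ≤ q := by exact_mod_cast (by omega : 4 ≤ q)
  have hkq : k ≤ q := by nlinarith
  refine ⟨ν, hkq, fun θ x hx => ?_⟩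
  have hr0 : (1 : ℝ) ≤ r := by exact_mod_cast hr
  obtain ⟨s, hs⟩ := exists_forall_add_one_sub_eq fun j => 1 / |a j|
  have hmono : Monotone s := monotone_int_of_le_succ fun j => by
    have : 0 ≤ 1 / |a j| := by positivity
    linarith [hs j]
  have hsr : ∀ n, k ^ 2 * r ≤ s (n + r) - s n := by
    intro n
    refine (hrK n).trans (le_of_eq ?_)
    have := Finset.sum_range_sub (fun i : ℕ => s (n + i)) r
    rw [Nat.cast_zero, add_zero] at this
    rw [← this]
    refine Finset.sum_congr rfl fun i _ => ?_
    rw [← hs]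
    push_cast
    rw [add_assoc]
  have hsm : ∀ m : ℕ, ∀ n, (k : ℝ) ^ 2 * (m * r : ℕ) ≤ s (n + (m * r : ℕ)) - s n := by
    intro m
    induction m with
    | zero => simp
    | succ m ih =>
      intro n
      have h1 := ih n
      have h2 := hsr (n + (m * r : ℕ))
      rw [show n + ((m + 1) * r : ℕ) = n + (m * r : ℕ) + r by push_cast; ring]
      push_cast at h1 h2 ⊢
      linarith
  set m := q / (k * r) with hm
  set N := m * r with hN
  have hkr : 0 < k * r := by positivity
  have hm1 : 1 ≤ m := (Nat.one_le_div_iff hkr).mpr (by omega)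
  have hkN : k * N ≤ q := by
    have := Nat.div_mul_le_self q (k * r)
    calc k * N = m * (k * r) := by rw [hN]; ring
      _ ≤ q := this
  have hNq : q ≤ 2 * (k * N) := by
    have h1 := Nat.lt_div_mul_add (a := q) hkr
    rw [← hm] at h1
    have : k * N = m * (k * r) := by rw [hN]; ring
    nlinarith
  have hN0 : 0 < N := by positivity
  have hN2 : 2 * N ≤ q := by nlinarith
  have hN0' : (0 : ℝ) < N := by exact_mod_cast hN0
  set T : ℝ := k ^ 2 * N / 2 with hT
  have hT0 : 0 < T := by positivity
  obtain ⟨ψ, hψ⟩ := exists_isQuasimode_coupling hμ θ ((1 + μ) / 2) x hx (1 / T) (by positivity)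
  obtain ⟨ψ', t, hψ', hloc⟩ := hψ.localize hT0 (s := s) fun j => by
    have : a j ≠ 0 := hne j
    rw [← ha, hs, abs_of_nonneg (one_div_nonneg.mpr (abs_nonneg (a j)))]
    exact (mul_one_div_cancel (abs_ne_zero.mpr this)).le
  obtain ⟨n, hn⟩ := exists_window_of_localized hmono
    (fun n => (by rw [hT]; linarith [hsm m n] : 2 * T ≤ s (n + N) - s n)) hψ'.2.1 hψ'.1 hloc
  set θ₁ := (1 + μ) / 2 + μ * (n - 1) with hθ₁
  obtain ⟨θ', hθ', hθ1, hθ2⟩ := exists_irrational_btwn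
    (show θ₁ < θ₁ + 1 / (q : ℝ) ^ 2 by linarith [show 0 < 1 / (q : ℝ) ^ 2 by positivity])
  have hsupp : ∀ j, ψ' (j + (n - 1)) ≠ 0 → 1 ≤ j ∧ j ≤ N := fun j hj => by
    have := hn _ hj
    omega
  have hk0' : (0 : ℝ) < k := by linarith
  have hq0' : (0 : ℝ) < q := by linarith
  have hkN' : (k : ℝ) * N ≤ q := by exact_mod_cast hkN
  have hNq' : (q : ℝ) ≤ 2 * (k * N) := by exact_mod_cast hNq
  have hkq' : (k : ℝ) ≤ q := by exact_mod_cast hkq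
  have key := (hψ'.translate (n - 1)).perturb (a' := coupling ν θ') (δ := 4 * π / (k * q))
    (by positivity) (by positivity) fun j hj => by
      have hj' : 0 ≤ j ∧ j ≤ N := by
        rcases hj with hj | hj
        · have := hsupp j hj; omega
        · have := hsupp (j + 1) hj; omega
      have hj0 : (0 : ℝ) ≤ j := by exact_mod_cast hj'.1
      have hj1 : (j : ℝ) ≤ N := by exact_mod_cast hj'.2
      refine (abs_coupling_sub_le ν θ' μ _ j (j + (n - 1)) 0).trans ?_
      have e : (ν : ℝ) * j + θ' - (μ * ((j + (n - 1) : ℤ) : ℝ) + (1 + μ) / 2) - 2 * ((0 : ℤ) : ℝ)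
          = (θ' - θ₁) - (μ - ν) * j := by
        rw [hθ₁]; push_cast; ring
      rw [e]
      have h1 : |θ' - θ₁| ≤ 1 / (k * q) := by
        rw [abs_of_pos (by linarith)]
        calc θ' - θ₁ ≤ 1 / (q : ℝ) ^ 2 := by linarith
          _ ≤ 1 / (k * q) := by
            gcongr
            nlinarith
      have h2 : |(μ - ν) * j| ≤ 1 / (k * q) := by
        rw [abs_mul, abs_of_nonneg hj0]
        calc |μ - ν| * j ≤ 1 / (q : ℝ) ^ 2 * N := by gcongr
          _ ≤ 1 / (q : ℝ) ^ 2 * (q / k) := by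
            gcongr
            rw [le_div_iff₀ hk0']; linarith
          _ = 1 / (k * q) := by field_simp
      calc 2 * π * |θ' - θ₁ - (μ - ν) * j| ≤ 2 * π * (1 / (k * q) + 1 / (k * q)) := by
            gcongr
            exact (abs_sub _ _).trans (add_le_add h1 h2)
        _ = 4 * π / (k * q) := by ring
  refine ⟨θ', _, coupling_ratCast_ne_zero ν hθ', key.mono ?_ ?_, fun j hj => ?_⟩
  · positivity
  · have h1 : 9 / T ≤ 36 / (k * q) := by
      rw [hT, div_le_div_iff₀ (by positivity) (by positivity)]
      nlinarith
    have h2 : 2 * (36 / (k * q : ℝ)) + 3 * (4 * π / (k * q)) = (72 + 12 * π) / (k * q) := by ring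
    calc 2 * (9 / T) + 3 * (4 * π / (k * q)) ≤ (72 + 12 * π) / (k * q) := by linarith
      _ ≤ 120 / (k * q) := by
        gcongr
        linarith [Real.pi_lt_four]
  · have := hsupp j hj
    omega

theorem norm_one_add_exp (t : ℝ) : ‖1 + Complex.exp (2 * t * Complex.I)‖ = |2 * Real.cos t| := by
  have : 1 + Complex.exp (2 * t * Complex.I)
      = ((2 * Real.cos t : ℝ) : ℂ) * Complex.exp (t * Complex.I) := by
    push_cast
    rw [Complex.cos, mul_div_cancel₀ _ two_ne_zero, add_mul, ← Complex.exp_add, ← Complex.exp_add,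
      neg_mul, neg_add_cancel, Complex.exp_zero, ← two_mul, ← mul_assoc, add_comm]
  rw [this, norm_mul, Complex.norm_exp_ofReal_mul_I, mul_one, Complex.norm_real, Real.norm_eq_abs]

theorem abs_coupling_eq_norm (ν : ℚ) (θ : ℝ) (j : ℕ) :
    |coupling ν θ j| =
      ‖1 - Complex.exp (2 * π * Complex.I * ν) ^ j * -Complex.exp (2 * π * Complex.I * θ)‖ := by
  rw [coupling, ← norm_one_add_exp, ← Complex.exp_nat_mul, mul_neg, sub_neg_eq_add,
    ← Complex.exp_add]
  congr 3
  push_cast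
  ring

theorem abs_prod_coupling_le (ν : ℚ) (θ : ℝ) :
    |∏ j ∈ Finset.range ν.den, coupling ν θ j| ≤ 2 := by
  rw [Finset.abs_prod]
  simp only [abs_coupling_eq_norm]
  rw [← norm_prod]
  have := congrArg (Polynomial.eval 1) (X_pow_sub_C_eq_prod (Complex.isPrimitiveRoot_exp_rat ν) ν.pos
    (α := -Complex.exp (2 * π * Complex.I * θ)) rfl)
  simp only [Polynomial.eval_sub, Polynomial.eval_pow, Polynomial.eval_X, one_pow,
    Polynomial.eval_C, Polynomial.eval_prod] at this
  rw [← this]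
  refine (norm_sub_le _ _).trans ?_
  rw [norm_one, norm_pow, norm_neg,
    show 2 * π * Complex.I * θ = ((2 * π * θ : ℝ) : ℂ) * Complex.I by push_cast; ring,
    Complex.norm_exp_ofReal_mul_I, one_pow]
  norm_num

theorem abs_prod_coupling_eq {ν : ℚ} {n : ℕ} (hn : ν.den = n + 1) :
    |∏ j ∈ Finset.range n, coupling ν (1 / 2 + ν) j| = ν.den := by
  rw [Finset.abs_prod]
  have h := Complex.isPrimitiveRoot_exp_rat ν
  rw [hn] at h
  have h2 := congrArg norm h.prod_one_sub_pow_eq_order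
  rw [norm_prod] at h2
  rw [hn]
  have h3 : ‖(n + 1 : ℂ)‖ = ((n + 1 : ℕ) : ℝ) := by
    rw [← Nat.cast_one, ← Nat.cast_add, Complex.norm_natCast]
  rw [← h3, ← h2]
  refine Finset.prod_congr rfl fun j _ => ?_
  rw [abs_coupling_eq_norm]
  congr 2
  have : Complex.exp (2 * π * Complex.I * ((1 / 2 + ν : ℝ) : ℂ))
      = -Complex.exp (2 * π * Complex.I * ν) := by
    rw [show 2 * π * Complex.I * ((1 / 2 + ν : ℝ) : ℂ)
      = π * Complex.I + 2 * π * Complex.I * ν by push_cast; ring, Complex.exp_add,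
      Complex.exp_pi_mul_I]
    ring
  rw [this, neg_neg, pow_succ]

/-- The product of the transfer matrices of a Jacobi operator with squared couplings `b`. -/
def transfer (x : ℝ) (b : ℕ → ℝ) : ℕ → Matrix (Fin 2) (Fin 2) ℝ
  | 0 => 1
  | n + 1 => !![x, -1; b n, 0] * transfer x b n

theorem transfer_congr {x : ℝ} {b b' : ℕ → ℝ} {n : ℕ} (h : ∀ j < n, b j = b' j) :
    transfer x b n = transfer x b' n := by
  induction n with
  | zero => rfl
  | succ n ih => rw [transfer, transfer, h n n.lt_succ_self, ih fun j hj => h j (by omega)]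

theorem transfer_succ' (x : ℝ) (b : ℕ → ℝ) (n : ℕ) :
    transfer x b (n + 1) = transfer x (fun i => b (i + 1)) n * !![x, -1; b 0, 0] := by
  induction n with
  | zero => simp [transfer]
  | succ n ih => rw [transfer, ih, transfer, Matrix.mul_assoc]

theorem trace_transfer_shift (x : ℝ) (b : ℕ → ℝ) {n : ℕ} (h : b n = b 0) :
    (transfer x (fun i => b (i + 1)) n).trace = (transfer x b n).trace := by
  cases n with
  | zero => rfl
  | succ n => rw [transfer_succ' x b, transfer, Matrix.trace_mul_comm, h]

theorem det_transfer (x : ℝ) (b : ℕ → ℝ) (n : ℕ) :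
    (transfer x b n).det = ∏ i ∈ Finset.range n, b i := by
  induction n with
  | zero => simp [transfer]
  | succ n ih =>
    rw [transfer, Matrix.det_mul, ih, Finset.prod_range_succ, Matrix.det_fin_two_of]
    ring

/-- Trigonometric polynomials of period one and degree at most `n`. -/
def trigPoly (n : ℕ) : Submodule ℂ (ℝ → ℂ) :=
  Submodule.span ℂ
    ((fun (k : ℤ) (t : ℝ) => Complex.exp (2 * π * Complex.I * k * t)) '' {k | |k| ≤ n})

theorem trigPoly_mono : Monotone trigPoly := fun m n h =>
  Submodule.span_mono (Set.image_mono fun k (hk : |k| ≤ m) => hk.trans (by exact_mod_cast h))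

theorem const_mem_trigPoly (c : ℂ) (n : ℕ) : (fun _ : ℝ => c) ∈ trigPoly n := by
  have h : (fun t : ℝ => Complex.exp (2 * π * Complex.I * (0 : ℤ) * t)) ∈ trigPoly n :=
    Submodule.subset_span ⟨0, by simp, rfl⟩
  convert Submodule.smul_mem _ c h using 1
  ext t
  simp

theorem exp_mul_mem_trigPoly {n : ℕ} {f : ℝ → ℂ} (hf : f ∈ trigPoly n) {m : ℤ} (hm : |m| ≤ 1) :
    (fun t : ℝ => Complex.exp (2 * π * Complex.I * m * t) * f t) ∈ trigPoly (n + 1) := by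
  induction hf using Submodule.span_induction with
  | mem f hf =>
    obtain ⟨k, hk, rfl⟩ := hf
    have hk : |k| ≤ n := hk
    refine Submodule.subset_span ⟨m + k, ?_, ?_⟩
    · have := abs_add_le m k
      push_cast
      show |m + k| ≤ n + 1
      omega
    · ext t
      simp only
      rw [← Complex.exp_add]
      congr 1
      push_cast
      ring
  | zero => simpa using const_mem_trigPoly 0 (n + 1)
  | add f g _ _ hf hg =>
    convert Submodule.add_mem _ hf hg using 1
    ext t; simp [mul_add]
  | smul c f _ hf =>
    convert Submodule.smul_mem _ c hf using 1
    ext t; simp [mul_left_comm]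

theorem ofReal_coupling_sq (ν : ℚ) (t : ℝ) (j : ℤ) : ((coupling ν t j ^ 2 : ℝ) : ℂ) =
    2 + Complex.exp (2 * π * Complex.I * ν * j) * Complex.exp (2 * π * Complex.I * (1 : ℤ) * t) +
      Complex.exp (-(2 * π * Complex.I * ν * j)) *
        Complex.exp (2 * π * Complex.I * (-1 : ℤ) * t) := by
  rw [coupling, ← Complex.exp_add, ← Complex.exp_add]
  push_cast
  rw [Complex.cos, mul_div_cancel₀ _ two_ne_zero, add_sq, mul_assoc 2, ← Complex.exp_add,
    ← Complex.exp_nat_mul, ← Complex.exp_nat_mul, neg_mul, add_neg_cancel, Complex.exp_zero]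
  push_cast
  ring_nf

theorem coupling_sq_mul_mem_trigPoly (ν : ℚ) (j : ℤ) {n : ℕ} {f : ℝ → ℂ} (hf : f ∈ trigPoly n) :
    (fun t => ((coupling ν t j ^ 2 : ℝ) : ℂ) * f t) ∈ trigPoly (n + 1) := by
  have h1 := Submodule.smul_mem _ (Complex.exp (2 * π * Complex.I * ν * j))
    (exp_mul_mem_trigPoly hf (m := 1) (by simp))
  have h2 := Submodule.smul_mem _ (Complex.exp (-(2 * π * Complex.I * ν * j)))
    (exp_mul_mem_trigPoly hf (m := -1) (by simp))
  have h3 := Submodule.smul_mem _ (2 : ℂ) (trigPoly_mono n.le_succ hf)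
  convert Submodule.add_mem _ (Submodule.add_mem _ h3 h1) h2 using 1
  ext t
  rw [ofReal_coupling_sq]
  simp only [Pi.add_apply, Pi.smul_apply, smul_eq_mul]
  ring

theorem transfer_mem_trigPoly (ν : ℚ) (x : ℝ) (n : ℕ) (i : Fin 2) :
    (fun t => ((transfer x (fun j => coupling ν t j ^ 2) n 0 i : ℝ) : ℂ)) ∈ trigPoly (n / 2) ∧
    (fun t => ((transfer x (fun j => coupling ν t j ^ 2) n 1 i : ℝ) : ℂ)) ∈
      trigPoly ((n + 1) / 2) := by
  induction n with
  | zero =>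
    simp only [transfer]
    exact ⟨const_mem_trigPoly _ _, const_mem_trigPoly _ _⟩
  | succ n ih =>
    simp only [transfer, Matrix.mul_apply, Fin.sum_univ_two]
    constructor
    · convert Submodule.sub_mem _ (Submodule.smul_mem _ (x : ℂ)
        (trigPoly_mono (Nat.div_le_div_right n.le_succ) ih.1)) ih.2 using 1
      ext t
      simp [sub_eq_add_neg]
    · convert coupling_sq_mul_mem_trigPoly ν n ih.1 using 1
      · congr 1
        omega
      · ext t
        simp

theorem sum_comp_add_eq_of_mem_trigPoly (ν : ℚ) {n : ℕ} (hn : n < ν.den) {f : ℝ → ℂ}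
    (hf : f ∈ trigPoly n) :
    ∃ c, ∀ t, ∑ m ∈ Finset.range ν.den, f (t + m * ν) = c := by
  induction hf using Submodule.span_induction with
  | mem f hf =>
    obtain ⟨k, hk, rfl⟩ := hf
    have hk : |k| ≤ n := hk
    set z := Complex.exp (2 * π * Complex.I * ν) with hz
    have hprim : IsPrimitiveRoot z ν.den := Complex.isPrimitiveRoot_exp_rat ν
    have e : ∀ t : ℝ, ∀ m : ℕ, Complex.exp (2 * π * Complex.I * k * ((t + m * ν : ℝ) : ℂ))
        = Complex.exp (2 * π * Complex.I * k * t) * (z ^ k) ^ m := by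
      intro t m
      rw [hz, ← Complex.exp_int_mul, ← Complex.exp_nat_mul, ← Complex.exp_add]
      congr 1
      push_cast
      ring
    simp only [e, ← Finset.mul_sum]
    by_cases hk0 : k = 0
    · subst hk0
      exact ⟨ν.den, fun t => by simp⟩
    · refine ⟨0, fun t => ?_⟩
      have h1 : z ^ k ≠ 1 := by
        intro h
        have := Int.eq_zero_of_abs_lt_dvd ((hprim.zpow_eq_one_iff_dvd k).mp h) (by omega)
        exact hk0 this
      have h2 : (z ^ k) ^ ν.den = 1 := by
        rw [← zpow_natCast, zpow_comm, zpow_natCast, hprim.pow_eq_one, one_zpow]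
      rw [geom_sum_eq h1, h2]
      simp
  | zero => exact ⟨0, fun t => by simp⟩
  | add f g _ _ hf hg =>
    obtain ⟨c, hc⟩ := hf
    obtain ⟨d, hd⟩ := hg
    exact ⟨c + d, fun t => by simp [Finset.sum_add_distrib, hc, hd]⟩
  | smul a f _ hf =>
    obtain ⟨c, hc⟩ := hf
    exact ⟨a * c, fun t => by simp [← Finset.mul_sum, hc]⟩

theorem coupling_sq_add_den (ν : ℚ) (θ : ℝ) (j : ℤ) :
    coupling ν θ (j + ν.den) ^ 2 = coupling ν θ j ^ 2 := by
  have : π * (ν * ((j + ν.den : ℤ) : ℝ) + θ) = π * (ν * j + θ) + ν.num * π := by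
    have : (ν : ℝ) * ν.den = ν.num := by exact_mod_cast Rat.mul_den_eq_num ν
    push_cast
    linear_combination π * this
  rw [coupling, this, coupling, mul_pow, mul_pow, Real.cos_add_int_mul_pi, mul_pow]
  have h : ((-1 : ℝ) ^ ν.num) ^ 2 = 1 := by
    rw [← zpow_natCast, ← zpow_mul, mul_comm, zpow_mul]
    simp
  rw [h, one_mul]

theorem trace_transfer_coupling_eq {ν : ℚ} (h2 : 2 ≤ ν.den) (x θ θ' : ℝ) :
    (transfer x (fun j => coupling ν θ j ^ 2) ν.den).trace =
      (transfer x (fun j => coupling ν θ' j ^ 2) ν.den).trace := by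
  set f : ℝ → ℝ := fun t => (transfer x (fun j => coupling ν t j ^ 2) ν.den).trace with hf
  have hper : ∀ t, f (t + ν) = f t := by
    intro t
    have h0 := coupling_sq_add_den ν t 0
    rw [zero_add] at h0
    rw [hf]
    dsimp only
    rw [← trace_transfer_shift x (fun j => coupling ν t j ^ 2) (n := ν.den) (by simpa using h0)]
    congr 2
    ext j
    rw [coupling, coupling]
    congr 4
    push_cast
    ring
  have hper' : ∀ m : ℕ, ∀ t, f (t + m * ν) = f t := by
    intro m
    induction m with
    | zero => simp
    | succ m ih =>
      intro t
      rw [← ih t, ← hper (t + m * ν)]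
      congr 1
      push_cast
      ring
  have hmem : (fun t => (f t : ℂ)) ∈ trigPoly ((ν.den + 1) / 2) := by
    simp only [hf, Matrix.trace_fin_two, Complex.ofReal_add]
    exact Submodule.add_mem _
      (trigPoly_mono (Nat.div_le_div_right ν.den.le_succ) (transfer_mem_trigPoly ν x _ 0).1)
      (transfer_mem_trigPoly ν x _ 1).2
  obtain ⟨c, hc⟩ := sum_comp_add_eq_of_mem_trigPoly ν (by omega) hmem
  simp only [hper', Finset.sum_const, Finset.card_range, nsmul_eq_mul] at hc
  have h3 := (hc θ).trans (hc θ').symm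
  have h4 : (ν.den : ℂ) ≠ 0 := by exact_mod_cast ν.den_nz
  exact_mod_cast mul_left_cancel₀ h4 h3

theorem exists_eigenvector_of_norm_sub_le {E : Type*} [NormedAddCommGroup E]
    [InnerProductSpace ℝ E] [FiniteDimensional ℝ E] {T : E →ₗ[ℝ] E} (hT : T.IsSymmetric)
    {v : E} (hv : v ≠ 0) {x ε : ℝ} (hε : 0 ≤ ε) (h : ‖T v - x • v‖ ^ 2 ≤ ε ^ 2 * ‖v‖ ^ 2) :
    ∃ y w, w ≠ 0 ∧ T w = y • w ∧ |x - y| ≤ ε := by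
  by_contra! hcon
  set e := hT.eigenvectorBasis rfl
  set y := hT.eigenvalues rfl
  have h1 : ∀ i, ε < |x - y i| := fun i =>
    hcon (y i) (e i) (e.orthonormal.ne_zero i) (hT.apply_eigenvectorBasis rfl i)
  have h2 : ∀ i, inner ℝ (e i) (T v - x • v) = (y i - x) * inner ℝ (e i) v := by
    intro i
    have : T (e i) = y i • e i := hT.apply_eigenvectorBasis rfl i
    rw [inner_sub_right, ← hT, this, inner_smul_left, inner_smul_right]
    simp only [conj_trivial]
    ring
  rw [← e.sum_sq_norm_inner_right, ← e.sum_sq_norm_inner_right, Finset.mul_sum] at h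
  refine h.not_gt (Finset.sum_lt_sum (fun i _ => ?_) ?_)
  · rw [h2, norm_mul, mul_pow, Real.norm_eq_abs (y i - x), abs_sub_comm]
    gcongr
    exact (h1 i).le
  · have : ∃ i, inner ℝ (e i) v ≠ 0 := by
      by_contra! h0
      apply hv
      rw [← norm_eq_zero, ← sq_eq_zero_iff, ← e.sum_sq_norm_inner_right]
      simp [h0]
    obtain ⟨i, hi⟩ := this
    refine ⟨i, Finset.mem_univ i, ?_⟩
    rw [h2, norm_mul, mul_pow, Real.norm_eq_abs (y i - x), abs_sub_comm]
    have := norm_pos_iff.mpr hi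
    gcongr
    exact h1 i

/-- The Jacobi operator on a cycle of length `q`. -/
noncomputable def cyclicJacobi {q : ℕ} (α : ZMod q → ℝ) :
    EuclideanSpace ℝ (ZMod q) →ₗ[ℝ] EuclideanSpace ℝ (ZMod q) where
  toFun φ := WithLp.toLp 2 fun i => α i * φ (i + 1) + α (i - 1) * φ (i - 1)
  map_add' φ χ := by ext i; simp; ring
  map_smul' c φ := by ext i; simp; ring

theorem cyclicJacobi_apply {q : ℕ} (α : ZMod q → ℝ) (φ : EuclideanSpace ℝ (ZMod q)) (i : ZMod q) :
    cyclicJacobi α φ i = α i * φ (i + 1) + α (i - 1) * φ (i - 1) := rfl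

theorem isSymmetric_cyclicJacobi {q : ℕ} [NeZero q] (α : ZMod q → ℝ) :
    (cyclicJacobi α).IsSymmetric := by
  intro φ χ
  simp only [PiLp.inner_apply, cyclicJacobi_apply, inner_add_left, inner_add_right,
    Finset.sum_add_distrib]
  rw [add_comm]
  congr 1
  · refine Fintype.sum_equiv (Equiv.subRight (1 : ZMod q)) _ _ fun i => ?_
    simp
    ring
  · refine Fintype.sum_equiv (Equiv.addRight (1 : ZMod q)) _ _ fun i => ?_
    simp
    ring

theorem exists_cyclicJacobi_eigenvector {a ψ : ℤ → ℝ} {x ε : ℝ} {q : ℕ} [NeZero q] (hε : 0 ≤ ε)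
    (h : IsQuasimode a x ε ψ) (hψ : ∀ j, ψ j ≠ 0 → 1 ≤ j ∧ j + 1 < q) :
    ∃ y w, w ≠ 0 ∧ cyclicJacobi (fun i : ZMod q => a i.val) w = y • w ∧ |x - y| ≤ ε := by
  obtain ⟨hf, h0, hq⟩ := h
  set v : EuclideanSpace ℝ (ZMod q) := WithLp.toLp 2 fun i => ψ i.val with hv
  have hval : ∀ j : ℕ, j < q → ((j : ZMod q)).val = j := fun j hj => ZMod.val_natCast_of_lt hj
  have hout : ∀ j : ℤ, (j < 1 ∨ q ≤ j + 1) → ψ j = 0 := by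
    intro j hj
    by_contra h
    have := hψ j h
    omega
  have hinj : Function.Injective fun i : ZMod q => (i.val : ℤ) := fun i j hij =>
    ZMod.val_injective q (Int.ofNat_inj.mp hij)
  have hq2 : 2 < q := by
    obtain ⟨j, hj⟩ := Function.ne_iff.mp h0
    have := hψ j hj
    omega
  have hjac : ∀ i : ZMod q, cyclicJacobi (fun i : ZMod q => a i.val) v i = jacobi a ψ i.val := by
    intro i
    obtain ⟨j, hj, rfl⟩ : ∃ j < q, (j : ZMod q) = i := ⟨i.val, i.val_lt, ZMod.natCast_zmod_val i⟩
    rw [cyclicJacobi_apply, jacobi, hval j hj]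
    congr 1
    · rcases Nat.lt_or_ge (j + 1) q with hj1 | hj1
      · have := hval (j + 1) hj1
        push_cast at this
        simp only [hv]
        rw [this]
        simp
      · have hj' : ((j + 1 : ℕ) : ZMod q) = 0 := by rw [show j + 1 = q by omega]; simp
        push_cast at hj'
        rw [hout (j + 1) (by omega)]
        simp [hv, hj', hout]
    · rcases Nat.eq_zero_or_pos j with rfl | hj1
      · have h1 : ((0 : ℕ) - 1 : ZMod q) = ((q - 1 : ℕ) : ZMod q) := by
          rw [Nat.cast_sub (by omega)]; simp
        have h2 : v ((q - 1 : ℕ) : ZMod q) = 0 := by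
          simp only [hv]
          rw [hval _ (by omega)]
          exact hout _ (by omega)
        rw [h1, h2, hout _ (by simp)]
        simp
      · have h1 : ((j : ZMod q) - 1) = ((j - 1 : ℕ) : ZMod q) := by
          rw [Nat.cast_sub (by omega)]; simp
        have h2 : ((j - 1 : ℕ) : ℤ) = j - 1 := by omega
        rw [h1]
        simp only [hv]
        rw [hval _ (by omega), h2]
  have hnorm : ‖v‖ ^ 2 = ∑' j, ψ j ^ 2 := by
    rw [EuclideanSpace.norm_sq_eq, ← hinj.tsum_eq, tsum_fintype]
    · simp [hv]
    · intro j hj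
      have hj : ψ j ≠ 0 := fun h => hj (by simp [h])
      have := hψ j hj
      exact ⟨(j.toNat : ZMod q), by simp only; rw [hval _ (by omega)]; omega⟩
  refine exists_eigenvector_of_norm_sub_le (isSymmetric_cyclicJacobi _) (v := v) ?_ hε ?_
  · intro h
    obtain ⟨j, hj⟩ := Function.ne_iff.mp h0
    have hj' := hψ j hj
    apply hj
    have h1 : v (j.toNat : ZMod q) = 0 := by rw [h]; rfl
    simp only [hv] at h1
    rwa [hval _ (by omega), Int.toNat_of_nonneg (by omega)] at h1
  · rw [hnorm]
    refine le_trans ?_ hq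
    have hs := summable_sq_of_finite_support (finite_support_jacobi_sub hf a x)
    refine le_trans (le_of_eq ?_) (tsum_comp_le_tsum_of_inj hs (fun j => sq_nonneg _) hinj)
    rw [EuclideanSpace.norm_sq_eq, tsum_fintype]
    refine Finset.sum_congr rfl fun i _ => ?_
    rw [PiLp.sub_apply, hjac, Real.norm_eq_abs, sq_abs]
    rfl

theorem transfer_mulVec_cyclic {q : ℕ} {α : ZMod q → ℝ} {w : EuclideanSpace ℝ (ZMod q)} {y : ℝ}
    (h : cyclicJacobi α w = y • w) (n : ℕ) :
    (transfer y (fun j => α j ^ 2) n).mulVec ![w 0, α (-1) * w (-1)] =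
      (∏ j ∈ Finset.range n, α j) • ![w n, α (n - 1) * w (n - 1)] := by
  induction n with
  | zero => simp [transfer]
  | succ n ih =>
    have h1 : α n * w (n + 1) + α (n - 1) * w (n - 1) = y * w n := by
      rw [← cyclicJacobi_apply, h]; rfl
    rw [transfer, ← Matrix.mulVec_mulVec, ih, Matrix.mulVec_smul, Finset.prod_range_succ, mul_smul]
    congr 1
    ext i
    fin_cases i
    · simp [Matrix.mulVec, dotProduct]
      linarith
    · simp [Matrix.mulVec, dotProduct]
      ring

theorem trace_eq_two_mul_of_mulVec_eq {M : Matrix (Fin 2) (Fin 2) ℝ} {A : ℝ} {v : Fin 2 → ℝ}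
    (hv : v ≠ 0) (h : M.mulVec v = A • v) (hA : A ≠ 0) (hdet : M.det = A ^ 2) :
    M.trace = 2 * A := by
  have h1 : (M - A • 1).det = 0 := Matrix.exists_mulVec_eq_zero_iff.mp
    ⟨v, hv, by rw [Matrix.sub_mulVec, h, Matrix.smul_mulVec, Matrix.one_mulVec, sub_self]⟩
  rw [Matrix.det_fin_two] at h1 hdet
  simp at h1
  rw [Matrix.trace_fin_two]
  apply mul_left_cancel₀ hA
  linarith

theorem trace_transfer_eq_of_cyclicJacobi {q : ℕ} [NeZero q] {α : ZMod q → ℝ} (hα : ∀ i, α i ≠ 0)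
    {w : EuclideanSpace ℝ (ZMod q)} (hw : w ≠ 0) {y : ℝ} (h : cyclicJacobi α w = y • w) :
    (transfer y (fun j => α j ^ 2) q).trace = 2 * ∏ j ∈ Finset.range q, α j := by
  refine trace_eq_two_mul_of_mulVec_eq (v := ![w 0, α (-1) * w (-1)]) ?_ ?_
    (Finset.prod_ne_zero_iff.mpr fun j _ => hα j) ?_
  · intro h0
    apply hw
    have h1 : w 0 = 0 := congrFun h0 0
    have h2 : α (-1) * w (-1) = 0 := congrFun h0 1
    have key : ∀ n : ℕ, w n = 0 ∧ w (n - 1) = 0 := by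
      intro n
      induction n with
      | zero => simpa [h1, hα] using h2
      | succ n ih =>
        have h3 : α n * w (n + 1) + α (n - 1) * w (n - 1) = y * w n := by
          rw [← cyclicJacobi_apply, h]; rfl
        simp only [ih.1, ih.2, mul_zero, add_zero, mul_eq_zero, hα, false_or] at h3
        exact ⟨by push_cast; exact h3, by push_cast; simpa using ih.1⟩
    ext i
    simpa using (key i.val).1
  · have := transfer_mulVec_cyclic h q
    simpa using this
  · rw [det_transfer, Finset.prod_pow]

theorem exists_abs_trace_transfer_le {ν : ℚ} {θ x ε : ℝ} {ψ : ℤ → ℝ} (hε : 0 ≤ ε)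
    (hθ : ∀ j, coupling ν θ j ≠ 0) (h : IsQuasimode (coupling ν θ) x ε ψ)
    (hψ : ∀ j, ψ j ≠ 0 → 1 ≤ j ∧ j + 1 < ν.den) :
    ∃ y, |x - y| ≤ ε ∧ |(transfer y (fun j => coupling ν θ j ^ 2) ν.den).trace| ≤ 4 := by
  have : NeZero ν.den := ⟨ν.den_nz⟩
  obtain ⟨y, w, hw, hy, hxy⟩ := exists_cyclicJacobi_eigenvector hε h hψ
  refine ⟨y, hxy, ?_⟩
  have h1 := trace_transfer_eq_of_cyclicJacobi (fun i => hθ _) hw hy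
  have h2 : ∏ j ∈ Finset.range ν.den, coupling ν θ (j : ZMod ν.den).val =
      ∏ j ∈ Finset.range ν.den, coupling ν θ j :=
    Finset.prod_congr rfl fun j hj => by rw [ZMod.val_natCast_of_lt (Finset.mem_range.mp hj)]
  have h3 : transfer y (fun j => coupling ν θ (j : ZMod ν.den).val ^ 2) ν.den =
      transfer y (fun j => coupling ν θ j ^ 2) ν.den := by
    refine transfer_congr fun j hj => ?_
    rw [ZMod.val_natCast_of_lt hj]
  rw [h2, h3] at h1
  rw [h1, abs_mul, abs_two]
  linarith [abs_prod_coupling_le ν θ]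

theorem exists_abs_sub_mul_le_of_sum_nonneg {ι : Type*} [Fintype ι] [DecidableEq ι] [Nonempty ι]
    {E : ι → ℝ} (hE : Function.Injective E) {x : ℝ} (hx : ∀ j, E j ≠ x)
    (hS : 0 ≤ ∑ j, 1 / (x - E j)) :
    ∃ i, |x - E i| * |∏ j ∈ Finset.univ.erase i, (E i - E j)| ≤
      Real.exp 1 * |∏ j, (x - E j)| := by
  have hne : (Finset.univ.filter fun j => E j < x).Nonempty := by
    by_contra hemp
    rw [Finset.not_nonempty_iff_eq_empty, Finset.filter_eq_empty_iff] at hemp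
    refine hS.not_gt (Finset.sum_neg (fun j _ => ?_) Finset.univ_nonempty)
    rw [one_div, inv_lt_zero, sub_neg]
    exact lt_of_le_of_ne (not_lt.mp (hemp (Finset.mem_univ j))) (hx j).symm
  obtain ⟨i, hi, hmax⟩ := Finset.exists_max_image _ E hne
  rw [Finset.mem_filter] at hi
  set h := x - E i with hh
  have hpos : 0 < h := sub_pos.mpr hi.2
  have hfac : ∀ j ∈ Finset.univ.erase i, |E i - E j| ≤
      Real.exp (-h * (1 / (x - E j))) * |x - E j| := by
    intro j hj
    have hji : E j ≠ E i := fun heq => (Finset.ne_of_mem_erase hj) (hE heq)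
    have hne' : x - E j ≠ 0 := sub_ne_zero.mpr (hx j).symm
    have hr : E i - E j = (-h * (1 / (x - E j)) + 1) * (x - E j) := by
      field_simp
      rw [hh]; ring
    have hr0 : 0 ≤ -h * (1 / (x - E j)) + 1 := by
      have e : -h * (1 / (x - E j)) + 1 = (E i - E j) / (x - E j) := by
        field_simp
        rw [hh]; ring
      rw [e]
      rcases lt_or_gt_of_ne (hx j) with hlt | hgt
      · have := hmax j (Finset.mem_filter.mpr ⟨Finset.mem_univ j, hlt⟩)
        exact div_nonneg (by linarith) (by linarith)
      · exact div_nonneg_of_nonpos (by linarith [hi.2]) (by linarith)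
    rw [hr, abs_mul, abs_of_nonneg hr0]
    gcongr
    exact Real.add_one_le_exp _
  refine ⟨i, ?_⟩
  rw [Finset.abs_prod, Finset.abs_prod, ← Finset.mul_prod_erase _ _ (Finset.mem_univ i),
    mul_left_comm]
  gcongr
  calc ∏ j ∈ Finset.univ.erase i, |E i - E j|
      ≤ ∏ j ∈ Finset.univ.erase i, Real.exp (-h * (1 / (x - E j))) * |x - E j| :=
        Finset.prod_le_prod (fun j _ => abs_nonneg _) hfac
    _ = Real.exp (-h * ∑ j ∈ Finset.univ.erase i, 1 / (x - E j)) *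
        ∏ j ∈ Finset.univ.erase i, |x - E j| := by
        rw [Finset.prod_mul_distrib, ← Real.exp_sum, Finset.mul_sum]
    _ ≤ _ := by
        gcongr
        rw [Finset.sum_erase_eq_sub (Finset.mem_univ i), ← hh, mul_sub, neg_mul h (1 / h),
          mul_one_div_cancel hpos.ne']
        nlinarith

theorem exists_abs_sub_mul_le {ι : Type*} [Fintype ι] [DecidableEq ι] [Nonempty ι]
    {E : ι → ℝ} (hE : Function.Injective E) (x : ℝ) :
    ∃ i, |x - E i| * |∏ j ∈ Finset.univ.erase i, (E i - E j)| ≤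
      Real.exp 1 * |∏ j, (x - E j)| := by
  by_cases hx : ∃ i, E i = x
  · obtain ⟨i, rfl⟩ := hx
    exact ⟨i, by simp; positivity⟩
  push Not at hx
  rcases le_total 0 (∑ j, 1 / (x - E j)) with hS | hS
  · exact exists_abs_sub_mul_le_of_sum_nonneg hE hx hS
  · obtain ⟨i, hi⟩ := exists_abs_sub_mul_le_of_sum_nonneg (E := fun j => -E j) (x := -x)
      (neg_injective.comp hE) (fun j => by simpa using hx j) (by
        have e : ∀ j, 1 / (-x - -E j) = -(1 / (x - E j)) := fun j => by
          rw [← one_div_neg_eq_neg_one_div]; congr 1; ring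
        simp only [e, Finset.sum_neg_distrib]
        linarith)
    refine ⟨i, ?_⟩
    have e : ∀ a b : ℝ, |-a - -b| = |a - b| := fun a b => by
      rw [← abs_neg]; congr 1; ring
    simpa only [Finset.abs_prod, e] using hi

theorem exists_polynomial_transfer (b : ℕ → ℝ) (n : ℕ) : ∃ p r : Polynomial ℝ, p.Monic ∧
    p.natDegree = n ∧ r.degree < n ∧
    ∀ x, transfer x b n 0 0 = p.eval x ∧ transfer x b n 1 0 = r.eval x := by
  induction n with
  | zero => exact ⟨1, 0, Polynomial.monic_one, Polynomial.natDegree_one, by simp, by simp [transfer]⟩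
  | succ n ih =>
    obtain ⟨p, r, hp, hn, hr, h⟩ := ih
    have hXp : (Polynomial.X * p).Monic := Polynomial.monic_X.mul hp
    have hXd : (Polynomial.X * p).natDegree = n + 1 := by
      rw [Polynomial.natDegree_X_mul hp.ne_zero, hn]
    have hpd : p.degree = n := by rw [Polynomial.degree_eq_natDegree hp.ne_zero, hn]
    have hlt : r.degree < (Polynomial.X * p).degree := by
      rw [Polynomial.degree_eq_natDegree hXp.ne_zero, hXd]
      exact hr.trans (by exact_mod_cast n.lt_succ_self)
    refine ⟨Polynomial.X * p - r, Polynomial.C (b n) * p, hXp.sub_of_left hlt, ?_, ?_, fun x => ?_⟩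
    · rw [Polynomial.natDegree_sub_eq_left_of_natDegree_lt, hXd]
      rw [hXd]
      by_cases h0 : r = 0
      · simp [h0]
      · exact ((Polynomial.natDegree_lt_iff_degree_lt h0).mpr hr).trans n.lt_succ_self
    · refine (Polynomial.degree_mul_le_of_le Polynomial.degree_C_le hpd.le).trans_lt ?_
      rw [zero_add]
      exact_mod_cast n.lt_succ_self
    · simp [transfer, Matrix.mul_apply, Fin.sum_univ_two, h x, sub_eq_add_neg]

theorem transfer_zero_zero_add_two (x : ℝ) (b : ℕ → ℝ) (n : ℕ) :
    transfer x b (n + 2) 0 0 = x * transfer x b (n + 1) 0 0 - b n * transfer x b n 0 0 := by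
  simp [transfer, Matrix.vecMul, dotProduct, Fin.sum_univ_two, sub_eq_add_neg]

theorem trace_transfer_of_eq_zero {x : ℝ} {b : ℕ → ℝ} {n : ℕ} (h : b n = 0) :
    (transfer x b (n + 1)).trace = transfer x b (n + 1) 0 0 := by
  simp [transfer, Matrix.trace_fin_two, Matrix.vecMul, dotProduct, Fin.sum_univ_two, h]

/-- The formal eigenvector of a decoupled cyclic Jacobi operator. -/
noncomputable def formalEigenvector {q : ℕ} (α : ZMod q → ℝ) (x : ℝ) : EuclideanSpace ℝ (ZMod q) :=
  WithLp.toLp 2 fun i =>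
    transfer x (fun j => α j ^ 2) i.val 0 0 / ∏ j ∈ Finset.range i.val, α j

theorem formalEigenvector_natCast {n j : ℕ} (hj : j ≤ n) (α : ZMod (n + 1) → ℝ) (x : ℝ) :
    formalEigenvector α x j =
      transfer x (fun j => α j ^ 2) j 0 0 / ∏ i ∈ Finset.range j, α i := by
  rw [formalEigenvector]
  dsimp only
  rw [ZMod.val_natCast_of_lt (by omega)]

theorem natCast_ne_neg_one {n j : ℕ} (hj : j < n) : (j : ZMod (n + 1)) ≠ -1 := by
  intro h
  have h1 : ((j + 1 : ℕ) : ZMod (n + 1)) = 0 := by push_cast; rw [h]; ring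
  have h2 := Nat.le_of_dvd (by omega) ((ZMod.natCast_eq_zero_iff _ _).mp h1)
  omega

theorem natCast_eq_neg_one (n : ℕ) : (n : ZMod (n + 1)) = -1 := by
  have : ((n + 1 : ℕ) : ZMod (n + 1)) = 0 := ZMod.natCast_self _
  push_cast at this
  linear_combination this

theorem cyclicJacobi_formalEigenvector {n : ℕ} (hn : 0 < n) {α : ZMod (n + 1) → ℝ} (h0 : α (-1) = 0)
    (hα : ∀ i ≠ -1, α i ≠ 0) (x : ℝ) :
    x • formalEigenvector α x - cyclicJacobi α (formalEigenvector α x) =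
      EuclideanSpace.single (-1) (transfer x (fun j => α j ^ 2) (n + 1) 0 0 /
        ∏ j ∈ Finset.range n, α j) := by
  have hprod : ∀ j ≤ n, ∏ i ∈ Finset.range j, α i ≠ 0 := fun j hj =>
    Finset.prod_ne_zero_iff.mpr fun i hi =>
      hα _ (natCast_ne_neg_one ((Finset.mem_range.mp hi).trans_le hj))
  ext i
  obtain ⟨j, hj, rfl⟩ : ∃ j ≤ n, (j : ZMod (n + 1)) = i :=
    ⟨i.val, Nat.lt_succ_iff.mp i.val_lt, ZMod.natCast_zmod_val i⟩
  rw [PiLp.sub_apply, PiLp.smul_apply, cyclicJacobi_apply, formalEigenvector_natCast hj]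
  have hleft : α (j - 1) * formalEigenvector α x (j - 1) =
      (x * transfer x (fun j => α j ^ 2) j 0 0 - transfer x (fun j => α j ^ 2) (j + 1) 0 0) /
        ∏ i ∈ Finset.range j, α i := by
    cases j with
    | zero => simp [h0, transfer]
    | succ j =>
      have hαj : α j ≠ 0 := hα _ (natCast_ne_neg_one hj)
      have hpj := hprod j (by omega)
      push_cast
      rw [add_sub_cancel_right, formalEigenvector_natCast (by omega), transfer_zero_zero_add_two,
        Finset.prod_range_succ]
      field_simp
      ring
  have hright : α j * formalEigenvector α x (j + 1) =
      if j = n then 0 else transfer x (fun j => α j ^ 2) (j + 1) 0 0 /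
        ∏ i ∈ Finset.range j, α i := by
    split_ifs with hjn
    · rw [hjn, natCast_eq_neg_one, h0, zero_mul]
    · have hjn' : j < n := lt_of_le_of_ne hj hjn
      have hαj : α j ≠ 0 := hα _ (natCast_ne_neg_one hjn')
      have hpj := hprod j hj
      have := formalEigenvector_natCast (j := j + 1) hjn' α x
      push_cast at this
      rw [this, Finset.prod_range_succ]
      field_simp
  rw [hleft, hright]
  by_cases hjn : j = n
  · subst hjn
    simp [natCast_eq_neg_one]
    ring
  · have := natCast_ne_neg_one (lt_of_le_of_ne hj hjn)
    simp [hjn, this]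
    ring

theorem eq_smul_formalEigenvector {n : ℕ} {α : ZMod (n + 1) → ℝ} (h0 : α (-1) = 0)
    (hα : ∀ i ≠ -1, α i ≠ 0) {w : EuclideanSpace ℝ (ZMod (n + 1))} {y : ℝ}
    (h : cyclicJacobi α w = y • w) : w = w 0 • formalEigenvector α y := by
  ext i
  obtain ⟨j, hj, rfl⟩ : ∃ j ≤ n, (j : ZMod (n + 1)) = i :=
    ⟨i.val, Nat.lt_succ_iff.mp i.val_lt, ZMod.natCast_zmod_val i⟩
  have hprod : ∏ i ∈ Finset.range j, α i ≠ 0 :=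
    Finset.prod_ne_zero_iff.mpr fun i hi =>
      hα _ (natCast_ne_neg_one ((Finset.mem_range.mp hi).trans_le hj))
  have h1 := congrFun (transfer_mulVec_cyclic h j) 0
  simp [Matrix.mulVec, dotProduct, Fin.sum_univ_two, h0] at h1
  rw [PiLp.smul_apply, formalEigenvector_natCast hj, smul_eq_mul]
  field_simp
  linarith

theorem transfer_eq_zero_of_eigenvector {n : ℕ} {α : ZMod (n + 1) → ℝ} (h0 : α (-1) = 0)
    {w : EuclideanSpace ℝ (ZMod (n + 1))} {y : ℝ} (hw : w 0 ≠ 0)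
    (h : cyclicJacobi α w = y • w) : transfer y (fun j => α j ^ 2) (n + 1) 0 0 = 0 := by
  have h1 := congrFun (transfer_mulVec_cyclic h (n + 1)) 0
  rw [Finset.prod_range_succ, natCast_eq_neg_one, h0] at h1
  simp [Matrix.mulVec, dotProduct, Fin.sum_univ_two, h0, hw] at h1
  exact h1

theorem eq_prod_of_injective_of_eval_eq_zero {n : ℕ} {p : Polynomial ℝ} (hp : p.Monic)
    (hn : p.natDegree = n) {E : Fin n → ℝ} (hE : Function.Injective E)
    (h : ∀ i, p.eval (E i) = 0) : p = ∏ i, (Polynomial.X - Polynomial.C (E i)) := by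
  refine Polynomial.eq_of_degree_sub_lt_of_eval_finset_eq (Finset.univ.image E) ?_ ?_
  · rw [Finset.card_image_of_injective _ hE, Finset.card_univ, Fintype.card_fin]
    have hm := Polynomial.monic_prod_X_sub_C E Finset.univ
    have hd : (∏ i, (Polynomial.X - Polynomial.C (E i))).natDegree = n := by
      simp [Polynomial.natDegree_prod_of_monic _ _ fun i _ => Polynomial.monic_X_sub_C (E i)]
    have e1 : p.degree = (n : WithBot ℕ) := by rw [Polynomial.degree_eq_natDegree hp.ne_zero, hn]
    have e2 : (∏ i, (Polynomial.X - Polynomial.C (E i))).degree = (n : WithBot ℕ) := by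
      rw [Polynomial.degree_eq_natDegree hm.ne_zero, hd]
    rw [← e1]
    exact Polynomial.degree_sub_lt_left (e1.trans e2.symm) hp.ne_zero
      (hp.leadingCoeff.trans hm.leadingCoeff.symm)
  · intro x hx
    obtain ⟨i, -, rfl⟩ := Finset.mem_image.mp hx
    rw [h i, Polynomial.eval_prod, Finset.prod_eq_zero (Finset.mem_univ i) (by simp)]

theorem continuous_transfer (b : ℕ → ℝ) (n : ℕ) : Continuous fun x => transfer x b n 0 0 := by
  obtain ⟨p, r, -, -, -, h⟩ := exists_polynomial_transfer b n
  exact p.continuous.congr fun x => (h x).1.symm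

theorem continuous_formalEigenvector {q : ℕ} (α : ZMod q → ℝ) (i : ZMod q) :
    Continuous fun x => formalEigenvector α x i :=
  (continuous_transfer _ _).div_const _

theorem inner_formalEigenvector_mul {n : ℕ} (hn : 0 < n) {α : ZMod (n + 1) → ℝ}
    (h0 : α (-1) = 0) (hα : ∀ i ≠ -1, α i ≠ 0) {w : EuclideanSpace ℝ (ZMod (n + 1))} {y : ℝ}
    (h : cyclicJacobi α w = y • w) (x : ℝ) :
    (x - y) * inner ℝ w (formalEigenvector α x) =
      w (-1) * (transfer x (fun j => α j ^ 2) (n + 1) 0 0 / ∏ j ∈ Finset.range n, α j) := by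
  have h1 := congrArg (inner ℝ w) (cyclicJacobi_formalEigenvector hn h0 hα x)
  rw [inner_sub_right, inner_smul_right, ← isSymmetric_cyclicJacobi α w, h, inner_smul_left,
    EuclideanSpace.inner_single_right] at h1
  simp at h1
  linarith

theorem exists_roots_transfer {n : ℕ} (hn : 0 < n) {α : ZMod (n + 1) → ℝ}
    (h0 : α (-1) = 0) (hα : ∀ i ≠ -1, α i ≠ 0) :
    ∃ E : Fin (n + 1) → ℝ, Function.Injective E ∧
      (∀ x, transfer x (fun j => α j ^ 2) (n + 1) 0 0 = ∏ i, (x - E i)) ∧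
      ∑ i, 1 / |∏ j ∈ Finset.univ.erase i, (E i - E j)| ≤ 1 / |∏ j ∈ Finset.range n, α j| := by
  have hT := isSymmetric_cyclicJacobi α
  have hfin : Module.finrank ℝ (EuclideanSpace ℝ (ZMod (n + 1))) = n + 1 := by
    rw [finrank_euclideanSpace, ZMod.card]
  set e := hT.eigenvectorBasis hfin with he
  set E := hT.eigenvalues hfin with hEdef
  have hev : ∀ i, cyclicJacobi α (e i) = E i • e i := fun i => hT.apply_eigenvectorBasis hfin i
  have hv : ∀ i, e i = e i 0 • formalEigenvector α (E i) := fun i =>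
    eq_smul_formalEigenvector h0 hα (hev i)
  have hne : ∀ i, e i 0 ≠ 0 := fun i hi => by
    have := hv i
    rw [hi, zero_smul] at this
    exact e.orthonormal.ne_zero i this
  have hinj : Function.Injective E := by
    intro i k hik
    by_contra hne'
    have h1 : inner ℝ (e i) (e k) = 0 := e.orthonormal.2 hne'
    rw [hv i, hv k, hik, inner_smul_left, inner_smul_right] at h1
    have h2 : inner ℝ (formalEigenvector α (E k)) (formalEigenvector α (E k)) ≠ 0 := by
      rw [Ne, inner_self_eq_zero]
      intro hz
      have := hv k
      rw [hz, smul_zero] at this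
      exact e.orthonormal.ne_zero k this
    exact (mul_ne_zero (by simpa using hne i) (mul_ne_zero (hne k) h2)) h1
  have hprod : ∏ j ∈ Finset.range n, α j ≠ 0 :=
    Finset.prod_ne_zero_iff.mpr fun i hi => hα _ (natCast_ne_neg_one (Finset.mem_range.mp hi))
  obtain ⟨p, r, hp, hpn, -, hpt⟩ := exists_polynomial_transfer (fun j => α j ^ 2) (n + 1)
  have hP : ∀ x, transfer x (fun j => α j ^ 2) (n + 1) 0 0 = ∏ i, (x - E i) := fun x => by
    have hroot : ∀ i, p.eval (E i) = 0 := fun i =>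
      (hpt (E i)).1.symm.trans (transfer_eq_zero_of_eigenvector h0 (hne i) (hev i))
    refine (hpt x).1.trans ?_
    rw [eq_prod_of_injective_of_eval_eq_zero hp hpn hinj hroot]
    simp [Polynomial.eval_prod]
  refine ⟨E, hinj, hP, ?_⟩
  have hd : ∀ i, ∏ j ∈ Finset.univ.erase i, (E i - E j) ≠ 0 := fun i =>
    Finset.prod_ne_zero_iff.mpr fun j hj =>
      sub_ne_zero.mpr fun hij => (Finset.ne_of_mem_erase hj) (hinj hij).symm
  have hfun : ∀ i, (fun x => inner ℝ (e i) (formalEigenvector α x)) = fun x =>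
      e i (-1) * ((∏ j ∈ Finset.univ.erase i, (x - E j)) / ∏ j ∈ Finset.range n, α j) := by
    intro i
    refine Continuous.ext_on (dense_compl_singleton (E i)) ?_ (by fun_prop) fun x hx => ?_
    · simp only [PiLp.inner_apply]
      refine continuous_finsetSum _ fun k _ => ?_
      exact continuous_const.inner (continuous_formalEigenvector α k)
    · have h1 := inner_formalEigenvector_mul hn h0 hα (hev i) x
      rw [hP, ← Finset.mul_prod_erase _ _ (Finset.mem_univ i), mul_div_assoc, mul_left_comm] at h1
      exact mul_left_cancel₀ (sub_ne_zero.mpr hx) h1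
  have hterm : ∀ i, 1 / |∏ j ∈ Finset.univ.erase i, (E i - E j)| =
      |e i 0 * e i (-1)| * (1 / |∏ j ∈ Finset.range n, α j|) := by
    intro i
    have h1 := congrFun (hfun i) (E i)
    have h2 : e i 0 * inner ℝ (e i) (formalEigenvector α (E i)) = 1 := by
      rw [← inner_smul_right, ← hv i, real_inner_self_eq_norm_sq, e.orthonormal.1 i, one_pow]
    simp only at h1
    rw [h1] at h2
    have h3 : |e i 0 * e i (-1)| * |∏ j ∈ Finset.univ.erase i, (E i - E j)| =
        |∏ j ∈ Finset.range n, α j| := by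
      rw [← abs_mul]
      congr 1
      field_simp at h2
      linarith
    have h4 := abs_pos.mpr (hd i)
    have h5 := abs_pos.mpr hprod
    rw [← h3] at h5 ⊢
    have h6 : |e i 0 * e i (-1)| ≠ 0 := fun hz => by simp [hz] at h5
    field_simp
  simp only [hterm]
  rw [← Finset.sum_mul]
  refine mul_le_of_le_one_left (by positivity) ?_
  have hpars : ∀ k, ∑ i, e i k ^ 2 = 1 := fun k => by
    have := e.sum_sq_norm_inner_right (EuclideanSpace.single k (1 : ℝ))
    simpa [EuclideanSpace.inner_single_right] using this
  calc ∑ i, |e i 0 * e i (-1)| ≤ ∑ i, (e i 0 ^ 2 + e i (-1) ^ 2) / 2 := by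
        refine Finset.sum_le_sum fun i _ => abs_le.mpr ⟨?_, ?_⟩
        · nlinarith [sq_nonneg (e i 0 + e i (-1))]
        · nlinarith [sq_nonneg (e i 0 - e i (-1))]
    _ = 1 := by
        rw [← Finset.sum_div, Finset.sum_add_distrib, hpars, hpars]; norm_num

theorem coupling_half_add_eq_zero_iff (ν : ℚ) (j : ℤ) :
    coupling ν (1 / 2 + ν) j = 0 ↔ (ν.den : ℤ) ∣ j + 1 := by
  constructor
  · intro h
    obtain ⟨m, hm⟩ := exists_eq_of_coupling_eq_zero h
    have h1 : ν * (j + 1) = m := by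
      have : (ν : ℝ) * (j + 1) = m := by linarith
      exact_mod_cast this
    have h2 : ν.num * (j + 1) = m * ν.den := by
      have h3 : (ν.num : ℚ) = ν * ν.den := (Rat.mul_den_eq_num ν).symm
      have : (ν.num : ℚ) * (j + 1) = m * ν.den := by rw [h3, ← h1]; ring
      exact_mod_cast this
    have hc : IsCoprime (ν.den : ℤ) ν.num := by
      rw [Int.isCoprime_iff_nat_coprime]
      simpa using ν.reduced.symm
    exact hc.dvd_of_dvd_mul_left (Dvd.intro_left m h2.symm)
  · rintro ⟨m, hm⟩
    have h3 : (ν : ℝ) * (j + 1) = (ν.num * m : ℤ) := by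
      have h4 : ν * (j + 1) = (ν.num * m : ℤ) := by
        have : (j + 1 : ℚ) = ν.den * m := by exact_mod_cast hm
        rw [this, ← mul_assoc, Rat.mul_den_eq_num]
        push_cast
        ring
      exact_mod_cast h4
    rw [coupling, mul_eq_zero, Real.cos_eq_zero_iff]
    refine Or.inr ⟨ν.num * m, ?_⟩
    push_cast at h3 ⊢
    linear_combination π * h3

theorem exists_roots_trace_transfer {ν : ℚ} (h2 : 2 ≤ ν.den) :
    ∃ E : Fin ν.den → ℝ, Function.Injective E ∧
      (∀ θ x, (transfer x (fun j => coupling ν θ j ^ 2) ν.den).trace = ∏ i, (x - E i)) ∧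
      ∑ i, 1 / |∏ j ∈ Finset.univ.erase i, (E i - E j)| ≤ 1 / ν.den := by
  obtain ⟨n, hn⟩ : ∃ n, ν.den = n + 1 := ⟨ν.den - 1, by omega⟩
  set α : ZMod (n + 1) → ℝ := fun i => coupling ν (1 / 2 + ν) i.val with hα
  have hval : ∀ j < n + 1, α j = coupling ν (1 / 2 + ν) j := fun j hj => by
    simp only [hα, ZMod.val_natCast_of_lt hj]
  have h0 : α (-1) = 0 := by
    rw [← natCast_eq_neg_one, hval n n.lt_succ_self, coupling_half_add_eq_zero_iff, hn]
    simp
  have hne : ∀ i ≠ -1, α i ≠ 0 := by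
    intro i hi h
    obtain ⟨j, hj, rfl⟩ : ∃ j ≤ n, (j : ZMod (n + 1)) = i :=
      ⟨i.val, Nat.lt_succ_iff.mp i.val_lt, ZMod.natCast_zmod_val i⟩
    rw [hval j (by omega), coupling_half_add_eq_zero_iff, hn] at h
    have h3 := Int.le_of_dvd (by omega) h
    push_cast at h3
    exact hi (by rw [show j = n by omega, natCast_eq_neg_one])
  obtain ⟨E, hE, hP, hS⟩ := exists_roots_transfer (by omega) h0 hne
  have hprod : |∏ j ∈ Finset.range n, α j| = ν.den := by
    rw [← abs_prod_coupling_eq hn]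
    congr 1
    exact Finset.prod_congr rfl fun j hj => hval j ((Finset.mem_range.mp hj).trans n.lt_succ_self)
  rw [hprod] at hS
  have htr : ∀ θ x, (transfer x (fun j => coupling ν θ j ^ 2) ν.den).trace = ∏ i, (x - E i) := by
    intro θ x
    rw [trace_transfer_coupling_eq h2 x θ (1 / 2 + ν), ← hP, hn,
      ← trace_transfer_of_eq_zero (by rw [natCast_eq_neg_one, h0]; ring)]
    congr 1
    exact transfer_congr fun j hj => by rw [hval j hj]
  clear_value α
  have key : ∀ m, m = n + 1 → ∃ E' : Fin m → ℝ, Function.Injective E' ∧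
      (∀ x, ∏ i, (x - E' i) = ∏ i, (x - E i)) ∧
      ∑ i, 1 / |∏ j ∈ Finset.univ.erase i, (E' i - E' j)| =
        ∑ i, 1 / |∏ j ∈ Finset.univ.erase i, (E i - E j)| := by
    rintro m rfl
    exact ⟨E, hE, fun _ => rfl, rfl⟩
  obtain ⟨E', hE', hp', hs'⟩ := key _ hn
  exact ⟨E', hE', fun θ x => by rw [htr, hp'], hs'.trans_le hS⟩

theorem volume_eq_zero_of_forall_isQuasimode {μ : ℝ} (hμ : Irrational μ) {θ : ℝ} {S : Set ℝ}
    (hS : ∀ x ∈ S, ∀ ε > 0, ∃ ψ, IsQuasimode (coupling μ θ) x ε ψ) : volume S = 0 := by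
  have key : ∀ k : ℕ, 2 ≤ k → volume S ≤ ENNReal.ofReal ((8 * Real.exp 1 + 240) / k) := by
    intro k hk
    obtain ⟨ν, hν, h⟩ := exists_rat_forall_isQuasimode hμ hk
    obtain ⟨E, hE, hP, hsum⟩ := exists_roots_trace_transfer (hk.trans hν)
    have hkpos : (0 : ℝ) < k := by exact_mod_cast (by omega : 0 < k)
    have hνk : (k : ℝ) ≤ ν.den := by exact_mod_cast hν
    have hνpos : (0 : ℝ) < ν.den := hkpos.trans_le hνk
    have : Nonempty (Fin ν.den) := ⟨⟨0, ν.pos⟩⟩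
    set d : Fin ν.den → ℝ := fun i => |∏ j ∈ Finset.univ.erase i, (E i - E j)| with hd
    have hdpos : ∀ i, 0 < d i := fun i => abs_pos.mpr <|
      Finset.prod_ne_zero_iff.mpr fun j hj =>
        sub_ne_zero.mpr fun hij => (Finset.ne_of_mem_erase hj) (hE hij).symm
    set r : Fin ν.den → ℝ := fun i => 4 * Real.exp 1 * (1 / d i) + 120 / (k * ν.den) with hr
    have hr0 : ∀ i, 0 ≤ r i := fun i => by
      have := hdpos i
      simp only [hr]
      positivity
    have hsub : S ⊆ ⋃ i, Metric.closedBall (E i) (r i) := by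
      intro x hx
      obtain ⟨θ', ψ, hne, hq, hsupp⟩ := h θ x (hS x hx)
      obtain ⟨y, hxy, hy⟩ := exists_abs_trace_transfer_le (by positivity) hne hq hsupp
      rw [hP] at hy
      obtain ⟨i, hi⟩ := exists_abs_sub_mul_le hE y
      refine Set.mem_iUnion.mpr ⟨i, ?_⟩
      rw [Metric.mem_closedBall, Real.dist_eq]
      have h1 : |y - E i| ≤ 4 * Real.exp 1 * (1 / d i) := by
        rw [mul_one_div, le_div_iff₀ (hdpos i)]
        refine hi.trans ?_
        nlinarith [Real.exp_pos 1]
      calc |x - E i| ≤ |x - y| + |y - E i| := abs_sub_le _ _ _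
        _ ≤ r i := by simp only [hr]; linarith
    calc volume S ≤ volume (⋃ i, Metric.closedBall (E i) (r i)) := measure_mono hsub
      _ ≤ ∑ i, volume (Metric.closedBall (E i) (r i)) := measure_iUnion_fintype_le _ _
      _ = ENNReal.ofReal (∑ i, 2 * r i) := by
          rw [ENNReal.ofReal_sum_of_nonneg fun i _ => mul_nonneg two_pos.le (hr0 i)]
          simp only [Real.volume_closedBall]
      _ ≤ _ := by
          refine ENNReal.ofReal_le_ofReal ?_
          have e : ∑ i, 2 * r i = 8 * Real.exp 1 * ∑ i, 1 / d i + 240 / k := by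
            simp only [hr, mul_add, Finset.sum_add_distrib, Finset.mul_sum]
            congr 1
            · exact Finset.sum_congr rfl fun i _ => by ring
            · simp
              field_simp
              norm_num
          rw [e, add_div]
          gcongr
          rw [div_eq_mul_one_div]
          gcongr
          exact hsum.trans (by gcongr)
  have hlim : Tendsto (fun k : ℕ => ENNReal.ofReal ((8 * Real.exp 1 + 240) / k)) atTop (nhds 0) := by
    rw [← ENNReal.ofReal_zero]
    exact ENNReal.tendsto_ofReal (tendsto_const_div_atTop_nhds_zero_nat _)
  exact le_antisymm (ge_of_tendsto hlim (eventually_atTop.mpr ⟨2, key⟩)) zero_le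

theorem spectrum_eq_of_coupling {μ : ℝ} (hμ : Irrational μ) {θ θ' : ℝ}
    {L L' : lp (fun _ : ℤ => ℂ) 2 →L[ℂ] lp (fun _ : ℤ => ℂ) 2}
    (hL : ∀ (φ : lp (fun _ : ℤ => ℂ) 2) (j : ℤ),
      L φ j = (coupling μ θ j : ℂ) * φ (j + 1) + (coupling μ θ (j - 1) : ℂ) * φ (j - 1))
    (hL' : ∀ (φ : lp (fun _ : ℤ => ℂ) 2) (j : ℤ),
      L' φ j = (coupling μ θ' j : ℂ) * φ (j + 1) + (coupling μ θ' (j - 1) : ℂ) * φ (j - 1)) :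
    spectrum ℂ L ⊆ spectrum ℂ L' := by
  intro z hz
  have hre := (isSelfAdjoint_of_jacobi hL).mem_spectrum_eq_re hz
  rw [hre] at hz ⊢
  rw [mem_spectrum_iff_forall_exists_isQuasimode hL] at hz
  rw [mem_spectrum_iff_forall_exists_isQuasimode hL']
  exact exists_isQuasimode_coupling hμ θ θ' _ hz

/-- For irrational `μ` and `A_j = μ j + θ`, the spectrum of the chain
operator `L_A` is independent of `θ`, is contained in the reals, and viewed as a subset
of `ℝ` it is a nonempty compact set with no isolated points, empty interior, and
Lebesgue measure zero. -/
theorem chain_operator_cantor_spectrum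
    (μ : ℝ) (hμ : Irrational μ) (θ θ' : ℝ)
    (L L' : lp (fun _ : ℤ => ℂ) 2 →L[ℂ] lp (fun _ : ℤ => ℂ) 2)
    (hL : ∀ (φ : lp (fun _ : ℤ => ℂ) 2) (j : ℤ),
      L φ j = ((2 * Real.cos (π * (μ * j + θ)) : ℝ) : ℂ) * φ (j + 1)
        + ((2 * Real.cos (π * (μ * (j - 1) + θ)) : ℝ) : ℂ) * φ (j - 1))
    (hL' : ∀ (φ : lp (fun _ : ℤ => ℂ) 2) (j : ℤ),
      L' φ j = ((2 * Real.cos (π * (μ * j + θ')) : ℝ) : ℂ) * φ (j + 1)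
        + ((2 * Real.cos (π * (μ * (j - 1) + θ')) : ℝ) : ℂ) * φ (j - 1)) :
    spectrum ℂ L = spectrum ℂ L' ∧
    spectrum ℂ L ⊆ Set.range (Complex.ofReal) ∧
    (Complex.ofReal ⁻¹' spectrum ℂ L).Nonempty ∧
    IsCompact (Complex.ofReal ⁻¹' spectrum ℂ L) ∧
    (∀ x ∈ Complex.ofReal ⁻¹' spectrum ℂ L,
      AccPt x (Filter.principal (Complex.ofReal ⁻¹' spectrum ℂ L))) ∧
    interior (Complex.ofReal ⁻¹' spectrum ℂ L) = ∅ ∧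
    volume (Complex.ofReal ⁻¹' spectrum ℂ L) = 0 := by
  have hc : ∀ φ j, L φ j = (coupling μ θ j : ℂ) * φ (j + 1) + (coupling μ θ (j - 1) : ℂ) * φ (j - 1) :=
    fun φ j => by rw [hL]; simp only [coupling]; push_cast; rfl
  have hc' : ∀ φ j, L' φ j =
      (coupling μ θ' j : ℂ) * φ (j + 1) + (coupling μ θ' (j - 1) : ℂ) * φ (j - 1) :=
    fun φ j => by rw [hL']; simp only [coupling]; push_cast; rfl
  have hreal : spectrum ℂ L ⊆ Set.range Complex.ofReal := fun z hz =>
    ⟨z.re, ((isSelfAdjoint_of_jacobi hc).mem_spectrum_eq_re hz).symm⟩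
  have hvol : volume (Complex.ofReal ⁻¹' spectrum ℂ L) = 0 :=
    volume_eq_zero_of_forall_isQuasimode hμ fun x hx =>
      (mem_spectrum_iff_forall_exists_isQuasimode hc x).mp hx
  have : Nontrivial (lp (fun _ : ℤ => ℂ) 2) :=
    ⟨lp.single 2 0 1, 0, fun h => by simpa using congrArg (fun φ => φ 0) h⟩
  refine ⟨(spectrum_eq_of_coupling hμ hc hc').antisymm (spectrum_eq_of_coupling hμ hc' hc), hreal,
    ?_, Complex.isometry_ofReal.isClosedEmbedding.isCompact_preimage (spectrum.isCompact L),
    fun x hx => accPt_of_mem_spectrum hμ θ hc hx, ?_, hvol⟩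
  · obtain ⟨z, hz⟩ := spectrum.nonempty L
    obtain ⟨x, rfl⟩ := hreal hz
    exact ⟨x, hz⟩
  · exact Measure.interior_eq_empty_of_null hvol
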